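/- arXiv:2505.07130 — 6 statements merged into one kernel-verified Lean document; each statement's English description precedes it below -/
import Mathlib

section
/- Let m ≥ 5 be an odd integer and let n_1 = 2^{m−1} or n_1 = 2^{m−1} + 2^{(m−1)/2}. Then there exists a binary linear code (q = 2) with parameters [(3/2)·(n_1 − 2^{(m−1)/2}), m, (n_1 − 2^{(m−1)/2})/2]_2 and maximum weight n_1 − 2^{(m−1)/2} that is a minimal code violating the Ashikhmin-Barg condition. -/
open Finset BigOperators

/-- Ceiling division on naturals: `cdiv a b = ⌈a / b⌉`. -/
def cdiv (a b : ℕ) : ℕ := (a + b - 1) / b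

/-- The minimum Hamming weight of a nonzero codeword of a linear code. -/
noncomputable def wmin {F : Type} [Field F] [Fintype F] [DecidableEq F] {n : ℕ}
    (C : Submodule F (Fin n → F)) : ℕ :=
  sInf {w | ∃ c ∈ C, c ≠ (0 : Fin n → F) ∧ hammingNorm c = w}

/-- The maximum Hamming weight of a codeword of a linear code. -/
noncomputable def wmax {F : Type} [Field F] [Fintype F] [DecidableEq F] {n : ℕ}
    (C : Submodule F (Fin n → F)) : ℕ :=
  sSup {w | ∃ c ∈ C, hammingNorm c = w}

/-- A linear code is minimal if every nonzero codeword `c` is minimal: any codeword `c'`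
whose support is contained in the support of `c` is a scalar multiple of `c`. -/
def IsMinimalCode {F : Type} [Field F] [Fintype F] [DecidableEq F] {n : ℕ}
    (C : Submodule F (Fin n → F)) : Prop :=
  ∀ c ∈ C, c ≠ (0 : Fin n → F) → ∀ c' ∈ C,
    {i : Fin n | c' i ≠ 0} ⊆ {i : Fin n | c i ≠ 0} → ∃ l : F, c' = l • c

/-- A linear code is self-orthogonal if the standard inner product of any two codewords is 0. -/
def SelfOrthogonal {F : Type} [Field F] {n : ℕ} (C : Submodule F (Fin n → F)) : Prop :=
  ∀ c ∈ C, ∀ c' ∈ C, ∑ i, c i * c' i = 0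

/-- A linear `[n,k]_q` code is projective if it is the image of `x ↦ (x·g_1, …, x·g_n)` for
nonzero, pairwise linearly independent vectors `g_1, …, g_n ∈ F_q^k`. -/
def IsProjectiveCode {F : Type} [Field F] {n : ℕ} (k : ℕ) (C : Submodule F (Fin n → F)) : Prop :=
  ∃ g : Fin n → (Fin k → F),
    (∀ i, g i ≠ 0) ∧
    (∀ i j, i ≠ j → ∀ l : F, g i ≠ l • g j) ∧
    (C : Set (Fin n → F)) = {c | ∃ x : Fin k → F, c = fun i => ∑ t, x t * g i t}

/-- `Aw C w` is the number of codewords of `C` of Hamming weight `w`. -/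
noncomputable def Aw {F : Type} [Field F] [Fintype F] [DecidableEq F] {n : ℕ}
    (C : Submodule F (Fin n → F)) (w : ℕ) : ℕ :=
  Set.ncard {c : Fin n → F | c ∈ C ∧ hammingNorm c = w}

/-- The minimum weight, maximum weight and minimality of the image of a linear map, read off from
the weights of the images of the nonzero vectors. -/
theorem exists_minimal_code_of_weights {P ι : Type} [AddCommGroup P] [Module (ZMod 2) P]
    [Fintype ι] {N h : ℕ} (hN : Fintype.card ι = N) (Φ : P →ₗ[ZMod 2] (ι → ZMod 2)) (hh : 0 < h)
    (hlow : ∀ p, p ≠ 0 → h ≤ hammingNorm (Φ p)) (hup : ∀ p, hammingNorm (Φ p) ≤ 2 * h)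
    (hmin : ∃ p, hammingNorm (Φ p) = h) (hmax : ∃ p, hammingNorm (Φ p) = 2 * h)
    (hdisj : ∀ p q, hammingNorm (Φ p) = h → hammingNorm (Φ q) = h →
      hammingNorm (Φ (p + q)) ≠ 2 * h) :
    ∃ C : Submodule (ZMod 2) (Fin N → ZMod 2),
      Module.finrank (ZMod 2) C = Module.finrank (ZMod 2) P ∧ wmin C = h ∧ wmax C = 2 * h ∧
        IsMinimalCode C := by
  obtain ⟨σ⟩ : Nonempty (Fin N ≃ ι) := ⟨(Fintype.equivFinOfCardEq hN).symm⟩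
  set Ψ : P →ₗ[ZMod 2] (Fin N → ZMod 2) := (LinearMap.funLeft (ZMod 2) (ZMod 2) σ).comp Φ with hΨ
  have hwt : ∀ p, hammingNorm (Ψ p) = hammingNorm (Φ p) := by
    intro p
    simp only [hammingNorm]
    refine Finset.card_bij (fun i _ => σ i) ?_ (fun i _ j _ hij => σ.injective hij) ?_
    · intro i hi
      simpa [hΨ, LinearMap.funLeft_apply] using hi
    · intro j hj
      exact ⟨σ.symm j, by simpa [hΨ, LinearMap.funLeft_apply] using hj, by simp⟩
  simp only [← hwt] at hlow hup hmin hmax hdisj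
  have hker : ∀ p, Ψ p ≠ 0 → p ≠ 0 := by
    rintro p hp rfl
    exact hp (map_zero Ψ)
  have hinj : Function.Injective Ψ := by
    rw [injective_iff_map_eq_zero]
    intro p hp
    by_contra hne
    have := hlow p hne
    rw [hp, hammingNorm_zero] at this
    omega
  refine ⟨LinearMap.range Ψ, LinearMap.finrank_range_of_inj hinj, ?_, ?_, ?_⟩
  · refine IsLeast.csInf_eq ⟨?_, ?_⟩
    · obtain ⟨p, hp⟩ := hmin
      refine ⟨Ψ p, ⟨p, rfl⟩, ?_, hp⟩
      intro h0
      rw [h0, hammingNorm_zero] at hp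
      omega
    · rintro _ ⟨_, ⟨p, rfl⟩, hp, rfl⟩
      exact hlow p (hker p hp)
  · refine IsGreatest.csSup_eq ⟨?_, ?_⟩
    · obtain ⟨p, hp⟩ := hmax
      exact ⟨Ψ p, ⟨p, rfl⟩, hp⟩
    · rintro _ ⟨_, ⟨p, rfl⟩, rfl⟩
      exact hup p
  · rintro _ ⟨p, rfl⟩ hp _ ⟨q, rfl⟩ hsub
    by_cases hq : Ψ q = 0
    · exact ⟨0, by simp [hq]⟩
    by_cases hpq : Ψ (p + q) = 0
    · refine ⟨1, ?_⟩
      rw [map_add] at hpq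
      rw [one_smul, eq_comm, ← sub_eq_zero, ZModModule.sub_eq_add, hpq]
    exfalso
    have hadd : hammingNorm (Ψ (p + q)) + hammingNorm (Ψ q) = hammingNorm (Ψ p) := by
      simp only [hammingNorm]
      rw [← Finset.card_union_of_disjoint]
      · congr 1
        ext i
        have := @hsub i
        simp only [Set.mem_ofPred_eq] at this
        simp only [map_add, Pi.add_apply, Finset.mem_union, Finset.mem_filter, Finset.mem_univ,
          true_and]
        exact (by decide : ∀ x y : ZMod 2, (y ≠ 0 → x ≠ 0) → (x + y ≠ 0 ∨ y ≠ 0 ↔ x ≠ 0)) _ _ this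
      · rw [Finset.disjoint_left]
        intro i
        have := @hsub i
        simp only [Set.mem_ofPred_eq] at this
        simp only [map_add, Pi.add_apply, Finset.mem_filter, Finset.mem_univ, true_and]
        exact (by decide : ∀ x y : ZMod 2, (y ≠ 0 → x ≠ 0) → x + y ≠ 0 → ¬y ≠ 0) _ _ this
    have h1 := hlow _ (hker _ hpq)
    have h2 := hlow _ (hker _ hq)
    have h3 := hup p
    refine hdisj (p + q) q (by omega) (by omega) ?_
    rw [add_assoc, ZModModule.add_self, add_zero]
    omega

/-- A binary function that is flipped by some translation takes the value `1` half of the time. -/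
theorem two_mul_card_ne_zero_of_translate {V : Type*} [AddCommGroup V] [Fintype V]
    (g : V → ZMod 2) (x₀ : V) (hg : ∀ x, g (x + x₀) = g x + 1) :
    2 * #{x | g x ≠ 0} = Fintype.card V := by
  classical
  have hflip : #{x | g x ≠ 0} = #{x | ¬ g x ≠ 0} := by
    refine Finset.card_equiv (Equiv.addRight x₀) fun x => ?_
    simp only [Finset.mem_filter, Finset.mem_univ, true_and, Equiv.coe_addRight, hg]
    generalize g x = y
    revert y
    decide
  have := Finset.card_filter_add_card_filter_not (s := (Finset.univ : Finset V)) (fun x => g x ≠ 0)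
  rw [Finset.card_univ] at this
  omega

theorem exists_dotProduct_eq_one {n : ℕ} {α : Fin n → ZMod 2} (hα : α ≠ 0) :
    ∃ x₀, α ⬝ᵥ x₀ = 1 := by
  obtain ⟨i, hi⟩ := Function.ne_iff.mp hα
  refine ⟨Pi.single i 1, ?_⟩
  rw [dotProduct_single, mul_one]
  revert hi
  simp only [Pi.zero_apply]
  generalize α i = y
  revert y
  decide

/-- The indicator function of the pairs whose second component is a standard basis vector. -/
noncomputable def basisIndicator (E n : ℕ) (z : (Fin E → ZMod 2) × (Fin n → ZMod 2)) : ZMod 2 :=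
  open Classical in if ∃ i, z.2 = Pi.single i 1 then 1 else 0

/-- The codewords `u f + ℓ` for linear forms `ℓ` and `f` the function `basisIndicator`, followed by
`t` copies of `u` and by `r` zeros. -/
noncomputable def basisCode (E n t r : ℕ) :
    (ZMod 2 × (Fin E → ZMod 2) × (Fin n → ZMod 2)) →ₗ[ZMod 2]
      (((Fin E → ZMod 2) × (Fin n → ZMod 2)) ⊕ Fin t ⊕ Fin r → ZMod 2) where
  toFun p := Sum.elim
    (fun z => p.1 * basisIndicator E n z + (p.2.1 ⬝ᵥ z.1 + p.2.2 ⬝ᵥ z.2))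
    (Sum.elim (fun _ => p.1) (fun _ => 0))
  map_add' p q := by
    ext (z | _ | _)
    · simp [add_dotProduct]
      ring
    · simp
    · simp
  map_smul' c p := by
    ext (z | _ | _)
    · simp [smul_dotProduct]
      ring
    · simp
    · simp

theorem hammingNorm_basisCode (E n t r : ℕ) (u : ZMod 2) (α : Fin E → ZMod 2)
    (β : Fin n → ZMod 2) :
    hammingNorm (basisCode E n t r (u, α, β)) =
      #{z : (Fin E → ZMod 2) × (Fin n → ZMod 2) |
        u * basisIndicator E n z + (α ⬝ᵥ z.1 + β ⬝ᵥ z.2) ≠ 0} + if u = 0 then 0 else t := by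
  simp only [hammingNorm, Finset.card_filter, Fintype.sum_sum_type]
  congr 1
  by_cases hu : u = 0 <;> simp [basisCode, hu]

theorem two_mul_card_linear_ne_zero {E n : ℕ} {α : Fin E → ZMod 2} {β : Fin n → ZMod 2}
    (h : (α, β) ≠ 0) :
    2 * #{z : (Fin E → ZMod 2) × (Fin n → ZMod 2) | α ⬝ᵥ z.1 + β ⬝ᵥ z.2 ≠ 0} =
      2 ^ (E + n) := by
  obtain ⟨z₀, hz₀⟩ : ∃ z₀ : (Fin E → ZMod 2) × (Fin n → ZMod 2),
      α ⬝ᵥ z₀.1 + β ⬝ᵥ z₀.2 = 1 := by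
    by_cases hα : α = 0
    · have hβ : β ≠ 0 := by
        rintro rfl
        exact h (by rw [hα]; rfl)
      obtain ⟨y, hy⟩ := exists_dotProduct_eq_one hβ
      exact ⟨(0, y), by simpa using hy⟩
    · obtain ⟨x, hx⟩ := exists_dotProduct_eq_one hα
      exact ⟨(x, 0), by simpa using hx⟩
  rw [two_mul_card_ne_zero_of_translate _ z₀]
  · simp [pow_add]
  · intro z
    simp only [Prod.fst_add, Prod.snd_add, dotProduct_add, ← hz₀]
    ring

theorem card_basisIndicator_ne_zero_and (E n : ℕ)
    (g : (Fin E → ZMod 2) × (Fin n → ZMod 2) → Prop) [DecidablePred g] :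
    #{z | basisIndicator E n z ≠ 0 ∧ g z} =
      ∑ i : Fin n, #{x : Fin E → ZMod 2 | g (x, Pi.single i 1)} := by
  classical
  rw [← Finset.card_sigma]
  symm
  refine Finset.card_bij (fun s _ => (s.2, Pi.single s.1 1)) ?_ ?_ ?_
  · rintro ⟨i, x⟩ hs
    simp only [Finset.mem_sigma, Finset.mem_univ, Finset.mem_filter, true_and] at hs ⊢
    refine ⟨?_, hs⟩
    rw [basisIndicator, if_pos ⟨i, rfl⟩]
    exact one_ne_zero
  · rintro ⟨i, x⟩ _ ⟨j, y⟩ _ hs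
    simp only [Prod.mk.injEq] at hs
    obtain ⟨rfl, hij⟩ := hs
    have : i = j := by
      by_contra hne
      have := congrFun hij i
      simp [hne] at this
    rw [this]
  · rintro ⟨x, y⟩ hz
    simp only [Finset.mem_univ, Finset.mem_filter, true_and] at hz
    obtain ⟨h1, h2⟩ := hz
    by_cases hy : ∃ i, y = Pi.single i 1
    · obtain ⟨i, rfl⟩ := hy
      exact ⟨⟨i, x⟩, by simpa using h2, rfl⟩
    · exact absurd (if_neg hy) h1

/-- The number of support points of `basisIndicator` on which a linear form is nonzero. -/
noncomputable def basisOverlap {E n : ℕ} (α : Fin E → ZMod 2) (β : Fin n → ZMod 2) : ℕ :=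
  ∑ i : Fin n, #{x : Fin E → ZMod 2 | α ⬝ᵥ x + β i ≠ 0}

theorem basisOverlap_le {E n : ℕ} (α : Fin E → ZMod 2) (β : Fin n → ZMod 2) :
    basisOverlap α β ≤ n * 2 ^ E := by
  refine (Finset.sum_le_card_nsmul _ _ (2 ^ E) fun i _ => ?_).trans (by simp)
  exact (Finset.card_filter_le _ _).trans (by simp)

theorem le_basisOverlap {E n : ℕ} (hn : 2 ≤ n) {α : Fin E → ZMod 2} {β : Fin n → ZMod 2}
    (h : (α, β) ≠ 0) : 2 ^ E ≤ basisOverlap α β := by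
  by_cases hα : α = 0
  · have hβ : β ≠ 0 := by
      rintro rfl
      exact h (by rw [hα]; rfl)
    obtain ⟨i, hi⟩ := Function.ne_iff.mp hβ
    refine le_trans ?_ (Finset.single_le_sum (fun _ _ => Nat.zero_le _) (Finset.mem_univ i))
    have hi' : β i ≠ 0 := hi
    simp [hα, hi']
  · obtain ⟨x₀, hx₀⟩ := exists_dotProduct_eq_one hα
    have key : ∀ i, 2 * #{x : Fin E → ZMod 2 | α ⬝ᵥ x + β i ≠ 0} = 2 ^ E := by
      intro i
      rw [two_mul_card_ne_zero_of_translate _ x₀]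
      · simp
      · intro x
        rw [dotProduct_add, hx₀]
        ring
    have : 2 * basisOverlap α β = n * 2 ^ E := by
      simp [basisOverlap, Finset.mul_sum, key]
    nlinarith [Nat.zero_le (2 ^ E)]

theorem basisOverlap_single {E n : ℕ} (i : Fin n) :
    basisOverlap (0 : Fin E → ZMod 2) (Pi.single i 1) = 2 ^ E := by
  rw [basisOverlap, Finset.sum_eq_single i]
  · simp
  · intro j _ hj
    simp [hj]
  · simp

theorem card_basisIndicator_add (E n : ℕ) (α : Fin E → ZMod 2) (β : Fin n → ZMod 2) :
    #{z : (Fin E → ZMod 2) × (Fin n → ZMod 2) |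
        1 * basisIndicator E n z + (α ⬝ᵥ z.1 + β ⬝ᵥ z.2) ≠ 0} + 2 * basisOverlap α β =
      n * 2 ^ E +
        #{z : (Fin E → ZMod 2) × (Fin n → ZMod 2) | α ⬝ᵥ z.1 + β ⬝ᵥ z.2 ≠ 0} := by
  have h1 := card_basisIndicator_ne_zero_and E n (fun _ => True)
  have h2 := card_basisIndicator_ne_zero_and E n (fun z => α ⬝ᵥ z.1 + β ⬝ᵥ z.2 ≠ 0)
  have h3 : basisOverlap α β =
      #{z | basisIndicator E n z ≠ 0 ∧ α ⬝ᵥ z.1 + β ⬝ᵥ z.2 ≠ 0} := by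
    rw [h2]
    simp [basisOverlap]
  have h4 : n * 2 ^ E = #{z | basisIndicator E n z ≠ 0} := by
    simpa using h1.symm
  rw [h3, h4]
  simp only [Finset.card_filter, Finset.mul_sum, ← Finset.sum_add_distrib]
  refine Finset.sum_congr rfl fun z _ => ?_
  generalize basisIndicator E n z = x
  generalize α ⬝ᵥ z.1 + β ⬝ᵥ z.2 = y
  revert x y
  decide

/-- The code of `basisCode` for suitable multiplicities; here `T` is the
weight of the word given by `basisIndicator` alone. -/
theorem exists_minimal_code_of_multiplicity {E T h : ℕ} (hT : (E + 4) * 2 ^ E ≤ T)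
    (hh : h = min T (8 * (2 ^ E) ^ 2)) (hT8 : T ≠ 8 * (2 ^ E) ^ 2)
    (hmax : T + 8 * (2 ^ E) ^ 2 = 2 * h + 2 * 2 ^ E)
    (hlen : 16 * (2 ^ E) ^ 2 + T ≤ 3 * h + (E + 4) * 2 ^ E) :
    ∃ C : Submodule (ZMod 2) (Fin (3 * h) → ZMod 2),
      Module.finrank (ZMod 2) C = 2 * E + 5 ∧ wmin C = h ∧ wmax C = 2 * h ∧
        IsMinimalCode C := by
  set a := 2 ^ E with ha
  have hEa : E + 1 ≤ a := Nat.lt_two_pow_self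
  have hpow : 2 ^ (E + (E + 4)) = 16 * a ^ 2 := by
    rw [ha]
    ring
  have hk4 : (E + 4) * a ≤ 4 * a ^ 2 := by nlinarith
  have ha2 : a ≤ a ^ 2 := by nlinarith
  obtain ⟨t, rfl⟩ := Nat.exists_eq_add_of_le hT
  obtain ⟨r, hr⟩ := Nat.exists_eq_add_of_le (show 16 * a ^ 2 + t ≤ 3 * h by omega)
  have hu : ∀ u : ZMod 2, u = 0 ∨ u = 1 := by decide
  have w0 : ∀ α β, (α, β) ≠ 0 →
      hammingNorm (basisCode E (E + 4) t r (0, α, β)) = 8 * a ^ 2 := by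
    intro α β hne
    have := two_mul_card_linear_ne_zero hne
    rw [hammingNorm_basisCode]
    simp only [zero_mul, zero_add, if_true]
    omega
  have w1 : ∀ α β, (α, β) ≠ 0 → hammingNorm (basisCode E (E + 4) t r (1, α, β)) +
      2 * basisOverlap α β = (E + 4) * a + t + 8 * a ^ 2 := by
    intro α β hne
    have := two_mul_card_linear_ne_zero hne
    have := card_basisIndicator_add E (E + 4) α β
    rw [← ha] at this
    rw [hammingNorm_basisCode, if_neg one_ne_zero]
    omega
  have w10 : hammingNorm (basisCode E (E + 4) t r (1, 0, 0)) = (E + 4) * a + t := by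
    have := card_basisIndicator_add E (E + 4) 0 0
    rw [← ha] at this
    rw [hammingNorm_basisCode, if_neg one_ne_zero]
    simp only [basisOverlap, zero_dotProduct, Pi.zero_apply, add_zero, ne_eq, not_true_eq_false,
      Finset.filter_false, Finset.card_empty, Finset.sum_const_zero, mul_zero] at this ⊢
    omega
  have w00 : hammingNorm (basisCode E (E + 4) t r (0, 0, 0)) = 0 := by
    rw [show ((0 : ZMod 2), (0 : Fin E → ZMod 2), (0 : Fin (E + 4) → ZMod 2)) = 0 from rfl,
      map_zero, hammingNorm_zero]
  have hsingle : ((0 : Fin E → ZMod 2), (Pi.single 0 1 : Fin (E + 4) → ZMod 2)) ≠ 0 := by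
    intro h0
    have := congrFun (congrArg Prod.snd h0) 0
    simp at this
  have hdim : Module.finrank (ZMod 2)
      (ZMod 2 × (Fin E → ZMod 2) × (Fin (E + 4) → ZMod 2)) = 2 * E + 5 := by
    simp
    ring
  rw [← hdim]
  refine exists_minimal_code_of_weights
    (by simp only [Fintype.card_sum, Fintype.card_prod, Fintype.card_fun, ZMod.card,
          Fintype.card_fin, ← pow_add, hpow]; omega)
    (basisCode E (E + 4) t r) (by omega) ?_ ?_ ?_ ?_ ?_
  · rintro ⟨u, α, β⟩ hne
    by_cases h0 : (α, β) = 0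
    · obtain ⟨rfl, rfl⟩ := Prod.mk.inj h0
      obtain rfl | rfl := hu u
      · exact absurd rfl hne
      · omega
    · obtain rfl | rfl := hu u
      · have := w0 α β h0
        omega
      · have := w1 α β h0
        have := basisOverlap_le α β
        rw [← ha] at this
        omega
  · rintro ⟨u, α, β⟩
    by_cases h0 : (α, β) = 0
    · obtain ⟨rfl, rfl⟩ := Prod.mk.inj h0
      obtain rfl | rfl := hu u <;> omega
    · obtain rfl | rfl := hu u
      · have := w0 α β h0
        omega
      · have := w1 α β h0
        have := le_basisOverlap (by omega) h0
        rw [← ha] at this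
        omega
  · obtain hle | hle := le_total ((E + 4) * a + t) (8 * a ^ 2)
    · exact ⟨_, w10.trans (by omega)⟩
    · exact ⟨_, (w0 _ _ hsingle).trans (by omega)⟩
  · refine ⟨(1, 0, Pi.single 0 1), ?_⟩
    have := w1 _ _ hsingle
    rw [basisOverlap_single, ← ha] at this
    omega
  · have h0 : ∀ α β, hammingNorm (basisCode E (E + 4) t r (0, α, β)) = 0 ∨
        hammingNorm (basisCode E (E + 4) t r (0, α, β)) = 8 * a ^ 2 := by
      intro α β
      by_cases hne : (α, β) = 0
      · obtain ⟨rfl, rfl⟩ := Prod.mk.inj hne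
        exact Or.inl w00
      · exact Or.inr (w0 α β hne)
    have h1 : ∀ α β, (E + 4) * a + t ≤ hammingNorm (basisCode E (E + 4) t r (1, α, β)) := by
      intro α β
      by_cases hne : (α, β) = 0
      · obtain ⟨rfl, rfl⟩ := Prod.mk.inj hne
        exact w10.ge
      · have := w1 α β hne
        have := basisOverlap_le α β
        rw [← ha] at this
        omega
    rintro ⟨u, α, β⟩ ⟨v, γ, δ⟩ hp hq
    obtain rfl : u = v := by
      obtain rfl | rfl := hu u <;> obtain rfl | rfl := hu v
      · rfl
      · have := h0 α β
        have := h1 γ δ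
        omega
      · have := h0 γ δ
        have := h1 α β
        omega
      · rfl
    rw [Prod.mk_add_mk, Prod.mk_add_mk, CharTwo.add_self_eq_zero]
    have := h0 (α + γ) (β + δ)
    omega

/-- Proposition 4.8. -/
theorem minimal_code_violating_AB_from_Ding_codes
    {m : ℕ} (hm : 5 ≤ m) (hodd : Odd m)
    (n1 : ℕ) (hn1 : n1 = 2 ^ (m - 1) ∨ n1 = 2 ^ (m - 1) + 2 ^ ((m - 1) / 2)) :
    ∃ C : Submodule (ZMod 2) (Fin (3 * (n1 - 2 ^ ((m - 1) / 2)) / 2) → ZMod 2),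
      Module.finrank (ZMod 2) C = m ∧
      wmin C = (n1 - 2 ^ ((m - 1) / 2)) / 2 ∧
      wmax C = n1 - 2 ^ ((m - 1) / 2) ∧
      IsMinimalCode C ∧
      2 * wmin C ≤ (2 - 1) * wmax C := by
  obtain ⟨E, rfl⟩ : ∃ E, m = 2 * E + 5 := by
    obtain ⟨j, rfl⟩ := hodd
    exact ⟨j - 2, by omega⟩
  have hEa : E + 1 ≤ 2 ^ E := Nat.lt_two_pow_self
  have e1 : 2 ^ (2 * E + 5 - 1) = 16 * (2 ^ E) ^ 2 := by
    rw [show 2 * E + 5 - 1 = E + E + 4 by omega]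
    ring
  have e2 : 2 ^ ((2 * E + 5 - 1) / 2) = 4 * 2 ^ E := by
    rw [show (2 * E + 5 - 1) / 2 = E + 2 by omega]
    ring
  rw [e1, e2] at hn1
  rw [e2]
  have hk : 4 * 2 ^ E ≤ (E + 4) * 2 ^ E := Nat.mul_le_mul_right _ (by omega)
  have hk8 : (E + 4) * 2 ^ E + 2 * 2 ^ E ≤ 8 * (2 ^ E) ^ 2 := by nlinarith
  have ha2 : 2 ^ E ≤ (2 ^ E) ^ 2 := by nlinarith
  obtain ⟨h, hn, T, hT, hh, hT8, hmax, hlen⟩ : ∃ h, n1 - 4 * 2 ^ E = 2 * h ∧ ∃ T,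
      (E + 4) * 2 ^ E ≤ T ∧ h = min T (8 * (2 ^ E) ^ 2) ∧ T ≠ 8 * (2 ^ E) ^ 2 ∧
      T + 8 * (2 ^ E) ^ 2 = 2 * h + 2 * 2 ^ E ∧
      16 * (2 ^ E) ^ 2 + T ≤ 3 * h + (E + 4) * 2 ^ E := by
    generalize (E + 4) * 2 ^ E = k at *
    generalize (2 ^ E) ^ 2 = b at *
    generalize 2 ^ E = a at *
    obtain rfl | rfl := hn1
    · exact ⟨8 * b - 2 * a, by omega, 8 * b - 2 * a, by omega⟩
    · exact ⟨8 * b, by omega, 8 * b + 2 * a, by omega⟩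
  rw [hn, show 3 * (2 * h) / 2 = 3 * h by omega, show 2 * h / 2 = h by omega]
  obtain ⟨C, hC, hCmin, hCmax, hCm⟩ := exists_minimal_code_of_multiplicity hT hh hT8 hmax hlen
  exact ⟨C, hC, hCmin, hCmax, hCm, by omega⟩
end

section
/- Let q be an odd prime and m ≥ 3 an odd integer. Set d = q^{m−1} − q^{m−2} − q^{(m−3)/2} and n' = ⌈q·d/(q−1)⌉ − (q^{m−1} − q^{m−2} + q^{(m−3)/2}). Then there exists a linear code with parameters [q^{m−1} + n', m, d]_q and maximum weight q^{m−1} − q^{m−2} + q^{(m−3)/2} + n' that is a minimal code violating the Ashikhmin-Barg condition. -/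
open Finset BigOperators

open Matrix

section QuadSpace

variable {F : Type} [Field F] {s : ℕ}

/-- The ambient space of the parabolic quadric, in coordinates `(z, x, y)`. -/
abbrev QuadSpace (F : Type) (s : ℕ) : Type := F × (Fin s → F) × (Fin s → F)

/-- The parabolic quadratic form `z ^ 2 - x ⬝ y`. -/
def parabolicForm (v : QuadSpace F s) : F := v.1 ^ 2 - v.2.1 ⬝ᵥ v.2.2

/-- The standard bilinear form on `QuadSpace F s`. -/
def quadPairing : QuadSpace F s →ₗ[F] QuadSpace F s →ₗ[F] F :=
  LinearMap.mk₂ F (fun b v ↦ b.1 * v.1 + b.2.1 ⬝ᵥ v.2.1 + b.2.2 ⬝ᵥ v.2.2)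
    (by intros; simp [add_mul]; ring) (by intros; simp; ring)
    (by intros; simp [mul_add]; ring) (by intros; simp; ring)

lemma quadPairing_apply (b v : QuadSpace F s) :
    quadPairing b v = b.1 * v.1 + b.2.1 ⬝ᵥ v.2.1 + b.2.2 ⬝ᵥ v.2.2 := rfl

lemma quadPairing_ne_zero {b : QuadSpace F s} (hb : b ≠ 0) : quadPairing b ≠ 0 := by
  intro h
  refine hb (Prod.ext ?_ (Prod.ext ?_ ?_))
  · simpa [quadPairing_apply] using LinearMap.congr_fun h ((1, 0, 0) : QuadSpace F s)
  · exact dotProduct_eq_zero _ fun y ↦ by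
      simpa [quadPairing_apply] using LinearMap.congr_fun h ((0, y, 0) : QuadSpace F s)
  · exact dotProduct_eq_zero _ fun y ↦ by
      simpa [quadPairing_apply] using LinearMap.congr_fun h ((0, 0, y) : QuadSpace F s)

lemma parabolicForm_units_smul_ne_zero (u : Fˣ) (v : QuadSpace F s) :
    parabolicForm (u • v) ≠ 0 ↔ parabolicForm v ≠ 0 := by
  have : parabolicForm (u • v) = (u : F) ^ 2 * parabolicForm v := by
    simp [parabolicForm, Units.smul_def]
    ring
  simp [this]

end QuadSpace

section Counting

variable {F : Type} [Field F] [Fintype F] [DecidableEq F]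

/-- The fibres of a surjective additive map between finite groups all have the same size. -/
lemma card_mul_card_fiber {V W : Type} [AddCommGroup V] [AddCommGroup W] [Fintype V] [Fintype W]
    [DecidableEq W] (f : V →+ W) (hf : Function.Surjective f) (w : W) :
    Fintype.card W * #{v | f v = w} = Fintype.card V := by
  have key : ∀ w', #{v | f v = w'} = #{v | f v = w} := fun w' ↦
    AddMonoidHom.card_fiber_eq_of_mem_range f (hf w') (hf w)
  have := Finset.card_eq_sum_card_fiberwise (f := f) (s := univ) (t := univ) (by simp)
  rw [← Finset.card_univ (α := V), this, Finset.sum_congr rfl (fun w' _ ↦ key w')]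
  simp

lemma card_mul_card_linear_fiber {V : Type} [AddCommGroup V] [Module F V] [Fintype V]
    (f : V →ₗ[F] F) (hf : f ≠ 0) (a : F) :
    Fintype.card F * #{v | f v = a} = Fintype.card V :=
  card_mul_card_fiber f.toAddMonoidHom (LinearMap.surjective hf) a

variable {s : ℕ}

lemma card_mul_card_dotProduct_eq {x : Fin s → F} (hx : x ≠ 0) (a : F) :
    Fintype.card F * #{y | x ⬝ᵥ y = a} = Fintype.card F ^ s := by
  have := card_mul_card_linear_fiber (dotProductBilin F F x) (fun h ↦ hx ?_) a
  · simpa using this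
  · exact dotProduct_eq_zero x fun y ↦ by simpa using LinearMap.congr_fun h y

lemma card_sq_mul_card_dotProduct_eq {x b : Fin s → F} (hb : b ≠ 0) (hx : ∀ t : F, x ≠ t • b)
    (u w : F) :
    Fintype.card F ^ 2 * #{y | x ⬝ᵥ y = u ∧ b ⬝ᵥ y = w} = Fintype.card F ^ s := by
  obtain ⟨i, hi⟩ := Function.ne_iff.mp hb
  obtain ⟨j, hj⟩ := Function.ne_iff.mp (hx (x i / b i))
  simp only [Pi.zero_apply, Pi.smul_apply, smul_eq_mul] at hi hj
  obtain ⟨D, hD⟩ : ∃ D, D = b i * x j - b j * x i := ⟨_, rfl⟩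
  have hD0 : D ≠ 0 := by
    rintro rfl
    apply hj
    field_simp
    linear_combination -hD
  let f : (Fin s → F) →ₗ[F] F × F := (dotProductBilin F F x).prod (dotProductBilin F F b)
  have hf : Function.Surjective f := by
    rintro ⟨p, r⟩
    refine ⟨((p * b i - r * x i) / D) • Pi.single j 1 +
      ((r * x j - p * b j) / D) • Pi.single i 1, ?_⟩
    simp only [f, LinearMap.prod_apply, Function.prod, dotProductBilin_apply_apply, dotProduct_add,
      dotProduct_smul, dotProduct_single_one, smul_eq_mul, Prod.mk.injEq]
    constructor <;> field_simp <;> rw [hD] <;> ring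
  have := card_mul_card_fiber f.toAddMonoidHom hf (u, w)
  simpa [f, sq, Prod.ext_iff] using this

lemma card_quadSpace {F : Type} [Fintype F] :
    Fintype.card (QuadSpace F s) = Fintype.card F ^ (2 * s + 1) := by
  simp; ring

lemma card_filter_quadSpace {F : Type} [Fintype F] (P : QuadSpace F s → Prop) [DecidablePred P] :
    #{v | P v} = ∑ x, ∑ z, #{y | P (z, x, y)} := by
  simp only [Finset.card_filter, Fintype.sum_prod_type]
  exact Finset.sum_comm

lemma card_quadPairing_eq_zero {b : QuadSpace F s} (hb : b ≠ 0) :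
    #{v | quadPairing b v = 0} = Fintype.card F ^ (2 * s) := by
  have h := card_mul_card_linear_fiber _ (quadPairing_ne_zero hb) 0
  rw [card_quadSpace, pow_succ'] at h
  exact Nat.eq_of_mul_eq_mul_left Fintype.card_pos h

lemma card_parabolicForm_eq_zero :
    #{v : QuadSpace F s | parabolicForm v = 0} = Fintype.card F ^ (2 * s) := by
  refine Nat.eq_of_mul_eq_mul_left (Fintype.card_pos (α := F)) ?_
  rw [card_filter_quadSpace, Finset.mul_sum]
  have key (x : Fin s → F) :
      Fintype.card F * ∑ z, #{y | parabolicForm (z, x, y) = 0} = Fintype.card F ^ (s + 1) := by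
    rcases eq_or_ne x 0 with rfl | hx
    · rw [Finset.sum_eq_single 0]
      · simp [parabolicForm, pow_succ']
      · intro z _ hz
        simp [parabolicForm, hz]
      · simp
    · rw [Finset.mul_sum, Finset.sum_congr rfl (g := fun _ ↦ Fintype.card F ^ s)]
      · simp [pow_succ']
      · intro z _
        rw [← card_mul_card_dotProduct_eq hx (z ^ 2)]
        simp only [parabolicForm, sub_eq_zero, eq_comm (a := z ^ 2)]
  rw [Finset.sum_congr rfl fun x _ ↦ key x]
  simp; ring

/-- The number of zeros of the binary quadratic form `z ^ 2 + c t z + k t ^ 2`. -/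
def binaryZeros (c k : F) : ℕ := ∑ t, #{z : F | z ^ 2 + c * t * z + k * t ^ 2 = 0}

lemma card_quadratic_roots_le (b c : F) : #{z : F | z ^ 2 + b * z + c = 0} ≤ 2 := by
  rcases Finset.eq_empty_or_nonempty {z : F | z ^ 2 + b * z + c = 0} with h | ⟨z₀, h₀⟩
  · simp [h]
  · refine (Finset.card_le_card (t := {z₀, -b - z₀}) fun z hz ↦ ?_).trans Finset.card_le_two
    simp only [Finset.mem_filter, Finset.mem_univ, true_and, Finset.mem_insert,
      Finset.mem_singleton] at h₀ hz ⊢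
    have : (z - z₀) * (z - (-b - z₀)) = 0 := by linear_combination hz - h₀
    exact (mul_eq_zero.mp this).imp sub_eq_zero.mp sub_eq_zero.mp

lemma binaryZeros_eq_add (c k : F) :
    binaryZeros c k =
      1 + ∑ t ∈ univ.erase (0 : F), #{z : F | z ^ 2 + c * t * z + k * t ^ 2 = 0} := by
  rw [binaryZeros, ← Finset.add_sum_erase _ _ (mem_univ (0 : F))]
  simp [Finset.filter_eq']

lemma one_le_binaryZeros (c k : F) : 1 ≤ binaryZeros c k := by
  simp [binaryZeros_eq_add]

lemma binaryZeros_add_one_le (c k : F) : binaryZeros c k + 1 ≤ 2 * Fintype.card F := by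
  have h := Finset.sum_le_card_nsmul (univ.erase (0 : F))
    (fun t ↦ #{z : F | z ^ 2 + c * t * z + k * t ^ 2 = 0}) 2
    fun t _ ↦ card_quadratic_roots_le _ _
  have := Fintype.card_pos (α := F)
  rw [Finset.card_erase_of_mem (mem_univ _), Finset.card_univ, smul_eq_mul] at h
  rw [binaryZeros_eq_add]
  omega

lemma binaryZeros_of_not_isSquare {g : F} (hg : ¬ IsSquare g) : binaryZeros 0 (-g) = 1 := by
  rw [binaryZeros_eq_add, Nat.add_eq_left, Finset.sum_eq_zero]
  intro t ht
  refine Finset.card_eq_zero.mpr (Finset.filter_eq_empty_iff.mpr fun z _ hz ↦ hg ⟨z / t, ?_⟩)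
  have : t ≠ 0 := Finset.ne_of_mem_erase ht
  field_simp
  linear_combination -hz

lemma binaryZeros_one_zero : binaryZeros (1 : F) 0 + 1 = 2 * Fintype.card F := by
  rw [binaryZeros_eq_add, Finset.sum_congr rfl (g := fun _ ↦ 2)]
  · have := Fintype.card_pos (α := F)
    rw [Finset.sum_const, Finset.card_erase_of_mem (mem_univ _), Finset.card_univ, smul_eq_mul]
    omega
  · intro t ht
    have : t ≠ 0 := Finset.ne_of_mem_erase ht
    refine Eq.trans (congrArg Finset.card (Finset.ext fun z ↦ ?_))
      (Finset.card_pair (a := 0) (b := -t) (by simpa [eq_comm] using this))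
    simp only [Finset.mem_filter, Finset.mem_univ, true_and, Finset.mem_insert,
      Finset.mem_singleton]
    rw [← add_eq_zero_iff_eq_neg, ← mul_eq_zero]
    ring_nf

/-- The number of common zeros of the parabolic form and a linear form. -/
def sectionCard (b : QuadSpace F s) : ℕ := #{v | parabolicForm v = 0 ∧ quadPairing b v = 0}

lemma sectionCard_of_right_ne_zero {b : QuadSpace F s} (hb : b.2.2 ≠ 0) :
    (Fintype.card F : ℤ) ^ 2 * sectionCard b = Fintype.card F ^ (s + 1) *
      (Fintype.card F ^ s - Fintype.card F + binaryZeros b.1 (b.2.1 ⬝ᵥ b.2.2)) := by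
  obtain ⟨c, α, β⟩ := b
  simp only at hb
  set q := Fintype.card F with hq
  let g : (Fin s → F) → ℤ := fun x ↦
    q ^ 2 * ∑ z, (#{y | parabolicForm (z, x, y) = 0 ∧ quadPairing (c, α, β) (z, x, y) = 0} : ℤ)
  have hg (x) (hx : x ∉ Set.range fun t : F ↦ t • β) : g x - q ^ (s + 1) = 0 := by
    have key (z : F) : q ^ 2 * #{y | parabolicForm (z, x, y) = 0 ∧
        quadPairing (c, α, β) (z, x, y) = 0} = q ^ s := by
      rw [hq, ← card_sq_mul_card_dotProduct_eq hb (fun t h ↦ hx ⟨t, h.symm⟩) (z ^ 2)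
        (-(c * z + α ⬝ᵥ x))]
      simp only [parabolicForm, quadPairing_apply, sub_eq_zero, eq_comm (a := z ^ 2),
        add_eq_zero_iff_neg_eq, eq_comm (a := -(c * z + α ⬝ᵥ x))]
    simp only [g, Finset.mul_sum]
    rw [Finset.sum_congr rfl (g := fun _ ↦ (q : ℤ) ^ s) fun z _ ↦ by exact_mod_cast key z]
    simp [← hq]; ring
  have hspan (t : F) : g (t • β) =
      q ^ (s + 1) * #{z : F | z ^ 2 + c * t * z + (α ⬝ᵥ β) * t ^ 2 = 0} := by
    have key (z : F) : q * #{y | parabolicForm (z, t • β, y) = 0 ∧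
        quadPairing (c, α, β) (z, t • β, y) = 0} =
        q ^ s * if z ^ 2 + c * t * z + (α ⬝ᵥ β) * t ^ 2 = 0 then 1 else 0 := by
      have hiff (y : Fin s → F) : (parabolicForm (z, t • β, y) = 0 ∧
          quadPairing (c, α, β) (z, t • β, y) = 0) ↔
          (z ^ 2 + c * t * z + (α ⬝ᵥ β) * t ^ 2 = 0 ∧ β ⬝ᵥ y = -(c * z + t * (α ⬝ᵥ β))) := by
        simp only [parabolicForm, quadPairing_apply, smul_dotProduct, dotProduct_smul, smul_eq_mul]
        constructor
        · rintro ⟨h1, h2⟩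
          exact ⟨by linear_combination h1 + t * h2, by linear_combination h2⟩
        · rintro ⟨h1, h2⟩
          exact ⟨by linear_combination h1 - t * h2, by linear_combination h2⟩
      simp only [hiff]
      split_ifs with h
      · simpa [h] using card_mul_card_dotProduct_eq hb _
      · simp [h]
    rw [Finset.card_filter]
    push_cast
    simp only [g, Finset.mul_sum]
    refine Finset.sum_congr rfl fun z _ ↦ ?_
    have := key z
    zify at this
    rw [pow_two, mul_assoc, this]
    ring
  have hsum : ∑ t : F, (g (t • β) - q ^ (s + 1)) = ∑ x, (g x - q ^ (s + 1)) :=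
    Fintype.sum_of_injective (fun t : F ↦ t • β) (smul_left_injective F hb) _ _ hg fun _ ↦ rfl
  have hleft : (q : ℤ) ^ 2 * sectionCard (c, α, β) = ∑ x, g x := by
    simp only [g]
    rw [sectionCard, card_filter_quadSpace, ← Finset.mul_sum]
    push_cast
    rfl
  simp only [hspan, Finset.sum_sub_distrib, ← Finset.mul_sum] at hsum
  simp only [Finset.sum_const, Finset.card_univ, Fintype.card_pi, Fintype.card_fin,
    Finset.prod_const, nsmul_eq_mul, ← hq] at hsum
  rw [hleft, binaryZeros]
  push_cast at hsum ⊢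
  linear_combination -hsum

lemma sectionCard_swap (c : F) (α β : Fin s → F) :
    sectionCard (c, α, β) = sectionCard (c, β, α) := by
  refine Finset.card_equiv ((Equiv.refl F).prodCongr (Equiv.prodComm _ _)) fun v ↦ ?_
  simp only [Finset.mem_filter, Finset.mem_univ, true_and]
  simp [parabolicForm, quadPairing_apply, dotProduct_comm v.2.1, add_right_comm]

lemma sectionCard_fst {c : F} (hc : c ≠ 0) :
    (Fintype.card F : ℤ) ^ 2 * sectionCard ((c, 0, 0) : QuadSpace F s) =
      Fintype.card F ^ (s + 1) * (Fintype.card F ^ s - Fintype.card F +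
        (2 * Fintype.card F - 1 : ℕ)) := by
  have h1 : 1 ≤ 2 * Fintype.card F := by have := Fintype.card_pos (α := F); omega
  set q := Fintype.card F with hq
  let g : (Fin s → F) → ℤ := fun x ↦ q * #{y | x ⬝ᵥ y = 0}
  have hg (x) (hx : x ≠ 0) : g x = q ^ s := by
    simp only [g]
    exact_mod_cast card_mul_card_dotProduct_eq hx 0
  have h0 : g 0 = q * q ^ s := by simp [g, ← hq]
  have hleft : (q : ℤ) * sectionCard ((c, 0, 0) : QuadSpace F s) = ∑ x, g x := by
    rw [sectionCard, card_filter_quadSpace, ← Finset.mul_sum]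
    push_cast
    congr 1
    refine Finset.sum_congr rfl fun x _ ↦ ?_
    rw [Finset.sum_eq_single 0]
    · simp [parabolicForm, quadPairing_apply]
    · intro z _ hz
      simp [quadPairing_apply, hc, hz]
    · simp
  have hsum : ∑ x, (g x - q ^ s) = g 0 - q ^ s :=
    Finset.sum_eq_single 0 (fun x _ hx ↦ by rw [hg x hx, sub_self]) (by simp)
  rw [Finset.sum_sub_distrib] at hsum
  simp only [Finset.sum_const, Finset.card_univ, Fintype.card_pi, Fintype.card_fin,
    Finset.prod_const, nsmul_eq_mul, ← hq] at hsum
  push_cast [h1] at hsum ⊢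
  rw [pow_two, mul_assoc, hleft]
  linear_combination (q : ℤ) * hsum + q * h0

lemma exists_sectionCard {b : QuadSpace F s} (hb : b ≠ 0) : ∃ n : ℕ, 1 ≤ n ∧
    n + 1 ≤ 2 * Fintype.card F ∧ (Fintype.card F : ℤ) ^ 2 * sectionCard b =
      Fintype.card F ^ (s + 1) * (Fintype.card F ^ s - Fintype.card F + n) := by
  obtain ⟨c, α, β⟩ := b
  by_cases hβ : β = 0
  · by_cases hα : α = 0
    · subst hα hβ
      have hc : c ≠ 0 := by rintro rfl; exact hb rfl
      have := Fintype.card_pos (α := F)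
      exact ⟨_, by omega, by omega, sectionCard_fst hc⟩
    · exact ⟨_, one_le_binaryZeros _ _, binaryZeros_add_one_le _ _, by
        rw [sectionCard_swap]; exact sectionCard_of_right_ne_zero (b := (c, β, α)) hα⟩
  · exact ⟨_, one_le_binaryZeros _ _, binaryZeros_add_one_le _ _,
      sectionCard_of_right_ne_zero hβ⟩

end Counting

section Projective

open scoped LinearAlgebra.Projectivization

variable {F : Type} [Field F] [Fintype F]

/-- A scaling-invariant set of nonzero vectors is `q - 1` times as large as the set of points of
projective space it covers. -/
lemma card_sub_one_mul_card_filter_rep {V : Type} [AddCommGroup V] [Module F V] [Fintype V]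
    [Fintype (ℙ F V)] (P : V → Prop) [DecidablePred P] (h0 : ¬ P 0)
    (hP : ∀ (u : Fˣ) (v : V), P (u • v) ↔ P v) :
    (Fintype.card F - 1) * #{p : ℙ F V | P p.rep} = #{v | P v} := by
  classical
  rw [← Fintype.card_units, mul_comm, ← Finset.card_univ (α := Fˣ), ← Finset.card_product]
  refine Finset.card_bij (fun x _ ↦ x.2 • x.1.rep) ?_ ?_ ?_
  · intro x hx
    simpa [hP] using hx
  · rintro ⟨p, u⟩ _ ⟨p', u'⟩ _ h
    simp only at h
    have hpp : p = p' := by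
      rw [← p.mk_rep, ← p'.mk_rep, Projectivization.mk_eq_mk_iff]
      exact ⟨u⁻¹ * u', by rw [mul_smul, ← h, inv_smul_smul]⟩
    subst hpp
    have hu : (u : F) = u' := smul_left_injective F p.rep_nonzero h
    rw [Units.ext hu]
  · intro v hv
    have hv0 : v ≠ 0 := by
      rintro rfl
      simp [h0] at hv
    obtain ⟨a, ha⟩ := Projectivization.exists_smul_eq_mk_rep F v hv0
    refine ⟨(Projectivization.mk F v hv0, a⁻¹), ?_, ?_⟩
    · simpa [← ha, hP] using hv
    · simp [← ha]

variable (F) (s : ℕ) in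
/-- The points of projective space off the parabolic quadric. -/
abbrev OffQuadric : Type := {p : ℙ F (QuadSpace F s) // parabolicForm p.rep ≠ 0}

noncomputable instance {s : ℕ} : Fintype (ℙ F (QuadSpace F s)) := Fintype.ofFinite _

variable [DecidableEq F] {s : ℕ}

lemma card_offQuadric : Fintype.card (OffQuadric F s) = Fintype.card F ^ (2 * s) := by
  have h := card_sub_one_mul_card_filter_rep (F := F)
    (fun v : QuadSpace F s ↦ parabolicForm v ≠ 0) (by simp [parabolicForm])
    parabolicForm_units_smul_ne_zero
  have h2 := Finset.card_filter_add_card_filter_not (s := univ)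
    (fun v : QuadSpace F s ↦ parabolicForm v = 0)
  rw [card_parabolicForm_eq_zero, Finset.card_univ, card_quadSpace] at h2
  rw [Fintype.card_subtype]
  have hq : 1 < Fintype.card F := Fintype.one_lt_card
  refine Nat.eq_of_mul_eq_mul_left (Nat.sub_pos_of_lt hq) ?_
  rw [h, Nat.sub_mul, one_mul, ← pow_succ']
  exact Nat.eq_sub_of_add_eq' h2

variable (F s) in
/-- Evaluation of linear forms at the points off the parabolic quadric. -/
noncomputable def offQuadricEval : QuadSpace F s →ₗ[F] (OffQuadric F s → F) :=
  LinearMap.pi fun p ↦ quadPairing.flip p.1.rep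

lemma card_sub_one_mul_hammingNorm (b : QuadSpace F s) (hb : b ≠ 0) :
    ((Fintype.card F : ℤ) - 1) * hammingNorm (offQuadricEval F s b) =
      Fintype.card F ^ (2 * s + 1) - 2 * Fintype.card F ^ (2 * s) + sectionCard b := by
  have h := card_sub_one_mul_card_filter_rep (F := F)
    (fun v : QuadSpace F s ↦ parabolicForm v ≠ 0 ∧ quadPairing b v ≠ 0) (by simp)
    fun u v ↦ and_congr (parabolicForm_units_smul_ne_zero u v) (by simp [Units.smul_def])
  have hw : hammingNorm (offQuadricEval F s b) =
      #{p : ℙ F (QuadSpace F s) | parabolicForm p.rep ≠ 0 ∧ quadPairing b p.rep ≠ 0} := by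
    rw [hammingNorm, ← Finset.card_map (Function.Embedding.subtype _)]
    congr 1
    ext p
    simp only [Finset.mem_map, Finset.mem_filter, Finset.mem_univ, true_and]
    simp [offQuadricEval, and_comm]
  have hunion := Finset.card_union_add_card_inter
    {v : QuadSpace F s | parabolicForm v = 0} {v | quadPairing b v = 0}
  have hcompl := Finset.card_filter_add_card_filter_not (s := univ)
    (fun v : QuadSpace F s ↦ parabolicForm v = 0 ∨ quadPairing b v = 0)
  rw [← Finset.filter_or, ← Finset.filter_and, card_parabolicForm_eq_zero,
    card_quadPairing_eq_zero hb, ← sectionCard] at hunion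
  simp only [not_or, Finset.card_univ, card_quadSpace] at hcompl
  have hq : 1 ≤ Fintype.card F := Fintype.card_pos
  rw [← hw] at h
  simp only [ne_eq] at h
  zify [hq] at h hunion hcompl
  linarith

lemma hammingNorm_offQuadricEval {r : ℕ} {b : QuadSpace F (r + 1)} (hb : b ≠ 0) {n : ℕ}
    (hn : (Fintype.card F : ℤ) ^ 2 * sectionCard b = Fintype.card F ^ (r + 2) *
      (Fintype.card F ^ (r + 1) - Fintype.card F + n)) :
    ((Fintype.card F : ℤ) - 1) * (hammingNorm (offQuadricEval F (r + 1) b) -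
      (Fintype.card F ^ (2 * r + 2) - Fintype.card F ^ (2 * r + 1))) =
      Fintype.card F ^ r * (n - Fintype.card F) := by
  have hq : (Fintype.card F : ℤ) ≠ 0 := by exact_mod_cast Fintype.card_ne_zero
  have hsec : (sectionCard b : ℤ) = Fintype.card F ^ r *
      (Fintype.card F ^ (r + 1) - Fintype.card F + n) := by
    apply mul_left_cancel₀ (pow_ne_zero 2 hq)
    rw [hn]
    ring
  rw [mul_sub, card_sub_one_mul_hammingNorm b hb, hsec]
  ring

lemma hammingNorm_offQuadricEval_bounds {r : ℕ} {b : QuadSpace F (r + 1)} (hb : b ≠ 0) :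
    (Fintype.card F : ℤ) ^ (2 * r + 2) - Fintype.card F ^ (2 * r + 1) - Fintype.card F ^ r ≤
      hammingNorm (offQuadricEval F (r + 1) b) ∧
    hammingNorm (offQuadricEval F (r + 1) b) ≤
      (Fintype.card F : ℤ) ^ (2 * r + 2) - Fintype.card F ^ (2 * r + 1) + Fintype.card F ^ r := by
  obtain ⟨n, h1, h2, hn⟩ := exists_sectionCard hb
  have h := hammingNorm_offQuadricEval hb hn
  have hq : (0 : ℤ) < Fintype.card F - 1 := by
    have := Fintype.one_lt_card (α := F)
    omega
  have hr : (0 : ℤ) ≤ Fintype.card F ^ r := by positivity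
  zify at h1 h2
  constructor
  · refine le_of_mul_le_mul_left ?_ hq
    nlinarith [mul_le_mul_of_nonneg_left h1 hr]
  · refine le_of_mul_le_mul_left ?_ hq
    nlinarith [mul_le_mul_of_nonneg_left h2 hr]

lemma exists_hammingNorm_offQuadricEval_eq_min (hF : ringChar F ≠ 2) (r : ℕ) :
    ∃ b : QuadSpace F (r + 1), b ≠ 0 ∧ b.1 = 0 ∧
      (hammingNorm (offQuadricEval F (r + 1) b) : ℤ) =
        Fintype.card F ^ (2 * r + 2) - Fintype.card F ^ (2 * r + 1) - Fintype.card F ^ r := by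
  obtain ⟨g, hg⟩ := FiniteField.exists_nonsquare hF
  let b : QuadSpace F (r + 1) := (0, Pi.single 0 (-g), Pi.single 0 1)
  have hβ : b.2.2 ≠ 0 := by simp [b]
  have hb : b ≠ 0 := fun h ↦ hβ (by rw [h]; rfl)
  have hn := hammingNorm_offQuadricEval hb (sectionCard_of_right_ne_zero hβ)
  have hk : b.2.1 ⬝ᵥ b.2.2 = -g := by simp [b]
  rw [hk, show b.1 = 0 from rfl, binaryZeros_of_not_isSquare hg] at hn
  have hq : (Fintype.card F : ℤ) - 1 ≠ 0 := by
    have := Fintype.one_lt_card (α := F)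
    omega
  refine ⟨b, hb, rfl, mul_left_cancel₀ hq ?_⟩
  push_cast at hn
  linear_combination hn

lemma exists_hammingNorm_offQuadricEval_eq_max (r : ℕ) :
    ∃ b : QuadSpace F (r + 1), b.1 ≠ 0 ∧
      (hammingNorm (offQuadricEval F (r + 1) b) : ℤ) =
        Fintype.card F ^ (2 * r + 2) - Fintype.card F ^ (2 * r + 1) + Fintype.card F ^ r := by
  let b : QuadSpace F (r + 1) := (1, 0, Pi.single 0 1)
  have hβ : b.2.2 ≠ 0 := by simp [b]
  have hb : b ≠ 0 := fun h ↦ hβ (by rw [h]; rfl)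
  have hn := hammingNorm_offQuadricEval hb (sectionCard_of_right_ne_zero hβ)
  have hk : b.2.1 ⬝ᵥ b.2.2 = 0 := by simp [b]
  rw [hk, show b.1 = 1 from rfl] at hn
  have hz := binaryZeros_one_zero (F := F)
  have hq : (Fintype.card F : ℤ) - 1 ≠ 0 := by
    have := Fintype.one_lt_card (α := F)
    omega
  refine ⟨b, one_ne_zero, mul_left_cancel₀ hq ?_⟩
  zify at hz
  linear_combination hn + (Fintype.card F : ℤ) ^ r * hz

end Projective

section Codes

variable {F : Type} [Field F] [Fintype F] [DecidableEq F] {V : Type} [AddCommGroup V] [Module F V]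
  {ι : Type} [Fintype ι]

/-- The Ashikhmin-Barg lemma: if the weights of the words `L b`, `b ≠ 0`, are close enough to each
other, supports determine words up to scalars. -/
lemma exists_smul_eq_of_support_subset (L : V →ₗ[F] (ι → F)) {wlo whi : ℕ}
    (hlo : ∀ b ≠ 0, wlo ≤ hammingNorm (L b)) (hhi : ∀ b, hammingNorm (L b) ≤ whi)
    (hAB : (Fintype.card F - 1) * whi < Fintype.card F * wlo) {b b' : V}
    (hsupp : ∀ i, L b' i ≠ 0 → L b i ≠ 0) : ∃ l : F, b' = l • b := by
  by_contra! hne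
  have hsum : ∑ l : F, hammingNorm (L (b' - l • b)) =
      (Fintype.card F - 1) * hammingNorm (L b) := by
    simp only [hammingNorm, Finset.card_filter]
    rw [Finset.sum_comm, Finset.mul_sum]
    refine Finset.sum_congr rfl fun i _ ↦ ?_
    by_cases hi : L b i = 0
    · have : L b' i = 0 := by_contra fun h ↦ hsupp i h hi
      simp [hi, this]
    · rw [← Finset.card_filter, if_pos hi, mul_one, ← Finset.card_univ,
        ← Finset.card_erase_of_mem (mem_univ (L b' i / L b i))]
      congr 1
      ext l
      simp only [map_sub, map_smul, Pi.sub_apply, Pi.smul_apply, smul_eq_mul, ne_eq,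
        Finset.mem_filter, Finset.mem_univ, true_and, Finset.mem_erase, and_true, sub_eq_zero,
        eq_div_iff hi, eq_comm (a := L b' i)]
  have hge := Finset.card_nsmul_le_sum univ (fun l : F ↦ hammingNorm (L (b' - l • b))) wlo
    fun l _ ↦ hlo _ (sub_ne_zero.mpr (hne l))
  rw [hsum, smul_eq_mul, Finset.card_univ] at hge
  exact absurd (hge.trans (Nat.mul_le_mul_left _ (hhi b))) hAB.not_ge

/-- Repeating a further linear functional `φ` `n'` times turns a code satisfying the
Ashikhmin-Barg condition into a minimal code with the same minimum weight and a maximum weight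
larger by `n'`, provided `φ` vanishes at some word of minimum weight and not at some word of
maximum weight. -/
lemma exists_minimal_code_of_repetition [Module.Finite F V] (L : V →ₗ[F] (ι → F)) (φ : V →ₗ[F] F)
    {wlo whi : ℕ} (hpos : 0 < wlo)
    (hlo : ∀ b ≠ 0, wlo ≤ hammingNorm (L b)) (hhi : ∀ b, hammingNorm (L b) ≤ whi)
    (hAB : (Fintype.card F - 1) * whi < Fintype.card F * wlo)
    {b₁ b₂ : V} (hb₁ : b₁ ≠ 0) (hw₁ : hammingNorm (L b₁) = wlo) (hφ₁ : φ b₁ = 0)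
    (hw₂ : hammingNorm (L b₂) = whi) (hφ₂ : φ b₂ ≠ 0)
    {N : ℕ} (hN : Fintype.card ι = N) (n' : ℕ) :
    ∃ C : Submodule F (Fin (N + n') → F), Module.finrank F C = Module.finrank F V ∧
      wmin C = wlo ∧ wmax C = whi + n' ∧ IsMinimalCode C := by
  let e : Fin N ≃ ι := (Fintype.equivFinOfCardEq hN).symm
  let E : V →ₗ[F] (Fin (N + n') → F) :=
    LinearMap.pi (Fin.append (fun i ↦ LinearMap.proj (e i) ∘ₗ L) fun _ ↦ φ)
  have hE_left (b : V) (i : Fin N) : E b (Fin.castAdd n' i) = L b (e i) := by simp [E]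
  have hE_right (b : V) (i : Fin n') : E b (Fin.natAdd N i) = φ b := by simp [E]
  have hnorm (b : V) : hammingNorm (E b) = hammingNorm (L b) + if φ b = 0 then 0 else n' := by
    simp only [hammingNorm, Finset.card_filter]
    rw [Fin.sum_univ_add]
    simp only [hE_left, hE_right]
    rw [e.sum_comp fun i ↦ if L b i ≠ 0 then 1 else 0]
    split_ifs with h <;> simp [h]
  have hinj : Function.Injective E := by
    rw [injective_iff_map_eq_zero]
    intro b hb
    by_contra hb0
    have h1 := hlo b hb0
    have h2 := hnorm b
    rw [hb, hammingNorm_zero] at h2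
    omega
  refine ⟨LinearMap.range E, LinearMap.finrank_range_of_inj hinj, ?_, ?_, ?_⟩
  · refine IsLeast.csInf_eq ⟨⟨E b₁, ⟨b₁, rfl⟩, ?_, ?_⟩, ?_⟩
    · exact fun h ↦ hb₁ (hinj (h.trans (map_zero E).symm))
    · simp [hnorm, hw₁, hφ₁]
    · rintro w ⟨_, ⟨b, rfl⟩, hb, rfl⟩
      rw [hnorm]
      exact (hlo b (by rintro rfl; exact hb (map_zero E))).trans (Nat.le_add_right _ _)
  · refine IsGreatest.csSup_eq ⟨⟨E b₂, ⟨b₂, rfl⟩, ?_⟩, ?_⟩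
    · simp [hnorm, hw₂, hφ₂]
    · rintro w ⟨_, ⟨b, rfl⟩, rfl⟩
      rw [hnorm]
      have := hhi b
      split_ifs <;> omega
  · rintro _ ⟨b, rfl⟩ _ _ ⟨b', rfl⟩ hsub
    obtain ⟨l, rfl⟩ := exists_smul_eq_of_support_subset L hlo hhi hAB (b := b) (b' := b')
      fun i hi ↦ by
        have := @hsub (Fin.castAdd n' (e.symm i)) (by simpa [hE_left] using hi)
        simpa [hE_left] using this
    exact ⟨l, map_smul E l b⟩

end Codes

lemma le_mul_cdiv (a : ℕ) {b : ℕ} (hb : 0 < b) : a ≤ b * cdiv a b := by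
  have h := Nat.div_add_mod (a + b - 1) b
  have := Nat.mod_lt (a + b - 1) hb
  rw [cdiv]
  omega

/-- Proposition 4.10. -/
theorem minimal_code_violating_AB_odd_prime
    {q : ℕ} (hq : q.Prime) (hqodd : Odd q)
    {F : Type} [Field F] [Fintype F] [DecidableEq F] (hcard : Fintype.card F = q)
    {m : ℕ} (hm : 3 ≤ m) (hmodd : Odd m)
    (d n' : ℕ)
    (hd : d = q ^ (m - 1) - q ^ (m - 2) - q ^ ((m - 3) / 2))
    (hn' : n' = cdiv (q * d) (q - 1) - (q ^ (m - 1) - q ^ (m - 2) + q ^ ((m - 3) / 2))) :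
    ∃ C : Submodule F (Fin (q ^ (m - 1) + n') → F),
      Module.finrank F C = m ∧
      wmin C = d ∧
      wmax C = q ^ (m - 1) - q ^ (m - 2) + q ^ ((m - 3) / 2) + n' ∧
      IsMinimalCode C ∧
      q * wmin C ≤ (q - 1) * wmax C := by
  obtain ⟨r, rfl⟩ : ∃ r, m = 2 * r + 3 := by
    obtain ⟨k, rfl⟩ := hmodd
    exact ⟨k - 1, by omega⟩
  have hq3 : 3 ≤ q := by
    have := hq.two_le
    obtain ⟨k, rfl⟩ := hqodd
    omega
  have hchar : ringChar F ≠ 2 := by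
    rw [Ne, FiniteField.even_card_iff_char_two, hcard]
    exact Nat.mod_two_ne_zero.mpr (Nat.odd_iff.mp hqodd)
  have hexp : (2 * r + 3 - 3) / 2 = r := by omega
  simp only [show 2 * r + 3 - 1 = 2 * r + 2 by omega, show 2 * r + 3 - 2 = 2 * r + 1 by omega,
    hexp] at hd hn' ⊢
  have hgap : 2 * q * q ^ r ≤ q ^ (2 * r + 2) - q ^ (2 * r + 1) := by
    have h1 : q ^ (2 * r + 2) - q ^ (2 * r + 1) = (q - 1) * (q ^ (r + 1) * q ^ r) := by
      rw [Nat.sub_mul, one_mul]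
      ring_nf
    rw [h1, ← mul_assoc]
    gcongr
    · omega
    · exact Nat.le_self_pow (by omega) q
  obtain ⟨W, hW⟩ : ∃ W, W = q ^ (2 * r + 2) - q ^ (2 * r + 1) := ⟨_, rfl⟩
  have hWz : (W : ℤ) = (q : ℤ) ^ (2 * r + 2) - q ^ (2 * r + 1) := by
    have : q ^ (2 * r + 1) ≤ q ^ (2 * r + 2) := Nat.pow_le_pow_right (by omega) (by omega)
    zify [this] at hW
    exact hW
  have hr : 1 ≤ q ^ r := Nat.one_le_pow _ _ (by omega)
  rw [← hW] at hd hn' hgap ⊢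
  have hle : q ^ r ≤ W := by nlinarith
  have hdz : (d : ℤ) = W - q ^ r := by
    rw [hd]
    push_cast [hle]
    rfl
  have hdpos : 0 < d := by
    rw [hd, Nat.sub_pos_iff_lt]
    nlinarith
  have hAB : (q - 1) * (W + q ^ r) < q * d := by
    zify [show 1 ≤ q by omega] at hgap hr ⊢
    rw [hdz]
    nlinarith
  obtain ⟨b₁, hb₁, hφ₁, hw₁⟩ := exists_hammingNorm_offQuadricEval_eq_min hchar r
  obtain ⟨b₂, hφ₂, hw₂⟩ := exists_hammingNorm_offQuadricEval_eq_max (F := F) r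
  have hlo (b : QuadSpace F (r + 1)) (hb : b ≠ 0) :
      d ≤ hammingNorm (offQuadricEval F (r + 1) b) := by
    have h := (hammingNorm_offQuadricEval_bounds hb).1
    rw [hcard, ← hWz, ← hdz] at h
    exact_mod_cast h
  have hhi (b : QuadSpace F (r + 1)) :
      hammingNorm (offQuadricEval F (r + 1) b) ≤ W + q ^ r := by
    rcases eq_or_ne b 0 with rfl | hb
    · simp
    · have h := (hammingNorm_offQuadricEval_bounds hb).2
      rw [hcard, ← hWz] at h
      exact_mod_cast h
  rw [hcard, ← hWz] at hw₁ hw₂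
  obtain ⟨C, hC, hmin, hmax, hminimal⟩ := exists_minimal_code_of_repetition
    (offQuadricEval F (r + 1)) (LinearMap.fst F F _) hdpos hlo hhi (by rwa [hcard]) hb₁
    (by rw [← hdz] at hw₁; exact_mod_cast hw₁) hφ₁ (by exact_mod_cast hw₂) hφ₂
    (N := q ^ (2 * r + 2)) (by rw [card_offQuadric, hcard]; rfl) n'
  refine ⟨C, ?_, hmin, hmax, hminimal, ?_⟩
  · refine hC.trans ?_
    simp
    omega
  · rw [hmin, hmax]
    refine (le_mul_cdiv (q * d) (b := q - 1) (by omega)).trans (Nat.mul_le_mul_left _ ?_)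
    omega
end

section
/- Let n ≥ 3 and h ≥ 1 be integers. If n is odd and 2^{n+h−3} > n − 1, then there exists a binary linear code (q = 2) with parameters [3·2^{n+h−2} − 3n + 1, n+h−1, 2^{n+h−2} − n + 1]_2 and maximum weight 2^{n+h−1} − 2n + 2 that is a minimal code violating the Ashikhmin-Barg condition. If n is even and 2^{n+h−3} > n, then there exists a binary linear code with parameters [3·2^{n+h−2} − 3n − 1, n+h−1, 2^{n+h−2} − n]_2 and maximum weight 2^{n+h−1} − 2n that is a minimal code violating the Ashikhmin-Barg condition. -/
open Finset BigOperators

section ColumnCode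

variable {V : Type} [AddCommGroup V] [Module (ZMod 2) V]

/-- The dual vectors that do not vanish at a given nonzero vector are half of the dual space. -/
lemma two_mul_card_dual_apply_ne_zero [Module.Finite (ZMod 2) V]
    [Fintype (Module.Dual (ZMod 2) V)] {x : V} (hx : x ≠ 0) :
    2 * #{f : Module.Dual (ZMod 2) V | f x ≠ 0} = 2 ^ Module.finrank (ZMod 2) V := by
  have hcard : Fintype.card (Module.Dual (ZMod 2) V) = 2 ^ Module.finrank (ZMod 2) V := by
    rw [Module.card_eq_pow_finrank (K := ZMod 2), Subspace.dual_finrank_eq, ZMod.card]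
  obtain ⟨g, hg⟩ : ∃ g : Module.Dual (ZMod 2) V, g x ≠ 0 := by
    by_contra! hcon
    exact hx ((Module.forall_dual_apply_eq_zero_iff (ZMod 2) x).1 hcon)
  have hswap : #{f : Module.Dual (ZMod 2) V | f x ≠ 0}
      = #{f : Module.Dual (ZMod 2) V | ¬ f x ≠ 0} := by
    refine Finset.card_equiv (Equiv.addRight g) fun f => ?_
    simp only [Finset.mem_filter, Finset.mem_univ, true_and, Equiv.coe_addRight,
      LinearMap.add_apply]
    generalize f x = s at *
    generalize g x = t at *
    revert s t
    decide
  have hsum := Finset.card_filter_add_card_filter_not (s := Finset.univ)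
    (fun f : Module.Dual (ZMod 2) V => f x ≠ 0)
  rw [Finset.card_univ, hcard] at hsum
  omega

/-- The code whose columns are all the nonzero dual vectors except the `P j`, together with `a`
copies of `q`. -/
def columnMap {n : ℕ} (P : Fin n → Module.Dual (ZMod 2) V) (q : Module.Dual (ZMod 2) V) (a : ℕ) :
    V →ₗ[ZMod 2] ({f : Module.Dual (ZMod 2) V // f ≠ 0 ∧ ∀ j, f ≠ P j} ⊕ Fin a → ZMod 2) :=
  LinearMap.pi (Sum.elim (fun f => f.1) fun _ => q)

lemma card_columns [Module.Finite (ZMod 2) V] {n : ℕ} {P : Fin n → Module.Dual (ZMod 2) V}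
    (hP : Function.Injective P) (hP0 : ∀ j, P j ≠ 0)
    [Fintype {f : Module.Dual (ZMod 2) V // f ≠ 0 ∧ ∀ j, f ≠ P j}] (a : ℕ) :
    Fintype.card ({f : Module.Dual (ZMod 2) V // f ≠ 0 ∧ ∀ j, f ≠ P j} ⊕ Fin a) + n + 1
      = 2 ^ Module.finrank (ZMod 2) V + a := by
  classical
  have : Finite (Module.Dual (ZMod 2) V) := Module.finite_of_finite (ZMod 2)
  have := Fintype.ofFinite (Module.Dual (ZMod 2) V)
  have hcard : Fintype.card (Module.Dual (ZMod 2) V) = 2 ^ Module.finrank (ZMod 2) V := by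
    rw [Module.card_eq_pow_finrank (K := ZMod 2), Subspace.dual_finrank_eq, ZMod.card]
  have h0 : (0 : Module.Dual (ZMod 2) V) ∉ Finset.univ.image P := by
    simpa using hP0
  have hset : ({f | f ≠ 0 ∧ ∀ j, f ≠ P j} : Finset (Module.Dual (ZMod 2) V))
      = (insert 0 (Finset.univ.image P))ᶜ := by
    ext f
    simp [eq_comm]
  have hcompl := Finset.card_add_card_compl (insert 0 (Finset.univ.image P))
  rw [Finset.card_insert_of_notMem h0, Finset.card_image_of_injective _ hP, Finset.card_univ,
    Fintype.card_fin, hcard] at hcompl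
  rw [Fintype.card_sum, Fintype.card_fin, Fintype.card_subtype, hset]
  omega

lemma hammingNorm_columnMap [Module.Finite (ZMod 2) V] {n : ℕ}
    {P : Fin n → Module.Dual (ZMod 2) V}
    (hP : Function.Injective P) (q : Module.Dual (ZMod 2) V)
    [Fintype {f : Module.Dual (ZMod 2) V // f ≠ 0 ∧ ∀ j, f ≠ P j}] (a : ℕ) {x : V} (hx : x ≠ 0) :
    2 * (hammingNorm (columnMap P q a x) + hammingNorm fun j => P j x)
      = 2 ^ Module.finrank (ZMod 2) V + 2 * if q x = 0 then 0 else a := by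
  classical
  have : Finite (Module.Dual (ZMod 2) V) := Module.finite_of_finite (ZMod 2)
  have := Fintype.ofFinite (Module.Dual (ZMod 2) V)
  have hsplit : hammingNorm (columnMap P q a x)
      = #{f : {f : Module.Dual (ZMod 2) V // f ≠ 0 ∧ ∀ j, f ≠ P j} | f.1 x ≠ 0}
        + if q x = 0 then 0 else a := by
    simp only [hammingNorm, Finset.card_filter, Fintype.sum_sum_type]
    congr 1
    by_cases hq : q x = 0 <;> simp [columnMap, hq]
  have hfst : #{f : {f : Module.Dual (ZMod 2) V // f ≠ 0 ∧ ∀ j, f ≠ P j} | f.1 x ≠ 0}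
      = #{f ∈ ({f | f x ≠ 0} : Finset (Module.Dual (ZMod 2) V)) | ¬ ∃ j, P j = f} := by
    refine Finset.card_bij (fun f _ => f.1) ?_ (fun _ _ _ _ h => Subtype.ext h) ?_
    · rintro ⟨f, hf0, hf⟩ hfx
      simp only [Finset.mem_filter, Finset.mem_univ, true_and] at hfx ⊢
      exact ⟨hfx, fun ⟨j, hj⟩ => hf j hj.symm⟩
    · intro f hf
      simp only [Finset.mem_filter, Finset.mem_univ, true_and, not_exists] at hf
      refine ⟨⟨f, ?_, fun j hj => hf.2 j hj.symm⟩, by simpa using hf.1, rfl⟩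
      rintro rfl
      exact hf.1 rfl
  have hsnd : hammingNorm (fun j => P j x)
      = #{f ∈ ({f | f x ≠ 0} : Finset (Module.Dual (ZMod 2) V)) | ∃ j, P j = f} := by
    refine Finset.card_bij (fun j _ => P j) ?_ (fun _ _ _ _ h => hP h) ?_
    · intro j hj
      simpa using hj
    · intro f hf
      simp only [Finset.mem_filter, Finset.mem_univ, true_and] at hf
      obtain ⟨hfx, j, rfl⟩ := hf
      exact ⟨j, by simpa using hfx, rfl⟩
  have htot := Finset.card_filter_add_card_filter_not
    (s := ({f | f x ≠ 0} : Finset (Module.Dual (ZMod 2) V))) (fun f => ∃ j, P j = f)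
  have hhalf := two_mul_card_dual_apply_ne_zero hx
  omega

end ColumnCode

lemma hammingNorm_add_of_support_subset {ι : Type} [Fintype ι] {c c' : ι → ZMod 2}
    (h : ∀ i, c' i ≠ 0 → c i ≠ 0) :
    hammingNorm c = hammingNorm c' + hammingNorm (c - c') := by
  simp only [hammingNorm, Finset.card_filter, ← Finset.sum_add_distrib]
  refine Finset.sum_congr rfl fun i _ => ?_
  have hi := h i
  have hsub : ∀ s t : ZMod 2, s ≠ 0 → t ≠ 0 → s - t = 0 := by decide
  rw [Pi.sub_apply]
  by_cases ht : c' i = 0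
  · simp [ht]
  · simp [ht, hi ht, hsub _ _ (hi ht) ht]

lemma hammingNorm_add_hammingNorm_sub_le {ι : Type} [Fintype ι] (c c' : ι → ZMod 2) :
    hammingNorm c' + hammingNorm (c - c') ≤ hammingNorm c + 2 * hammingNorm c' := by
  have h := hammingDist_triangle c' 0 c
  rw [hammingDist_zero_right, hammingDist_zero_left, hammingDist_eq_hammingNorm,
    neg_add_eq_sub] at h
  omega

/-- A binary code with two extreme weights `m` and `2 * m`, from a linear family of words whose
weights are controlled by those of an auxiliary code and by one functional `q`. -/
lemma exists_minimalCode_of_columns {V : Type} [AddCommGroup V] [Module (ZMod 2) V]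
    [Module.Finite (ZMod 2) V] {n M k : ℕ} (P : Fin n → Module.Dual (ZMod 2) V)
    (hP : Function.Injective P) (hP0 : ∀ j, P j ≠ 0) (q : Module.Dual (ZMod 2) V)
    (hk : Module.finrank (ZMod 2) V = k + 1)
    (hM : ∀ x, hammingNorm (fun j => P j x) ≤ M) (hMk : 2 * M < 2 ^ k)
    (hlo : ∃ x, x ≠ 0 ∧ q x = 0 ∧ hammingNorm (fun j => P j x) = M)
    (hhi : ∃ x, q x ≠ 0 ∧ hammingNorm (fun j => P j x) = 0)
    {N : ℕ} (hN : N + n + 1 + 2 * M = 3 * 2 ^ k) :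
    ∃ C : Submodule (ZMod 2) (Fin N → ZMod 2),
      Module.finrank (ZMod 2) C = k + 1 ∧
      wmin C = 2 ^ k - M ∧
      wmax C = 2 ^ (k + 1) - 2 * M ∧
      IsMinimalCode C := by
  classical
  have : Finite (Module.Dual (ZMod 2) V) := Module.finite_of_finite (ZMod 2)
  have := Fintype.ofFinite {f : Module.Dual (ZMod 2) V // f ≠ 0 ∧ ∀ j, f ≠ P j}
  set a := 2 ^ k - 2 * M with ha
  have hcard := card_columns hP hP0 a
  rw [hk, pow_succ] at hcard
  let e := Fintype.equivFinOfCardEq (show Fintype.card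
    ({f : Module.Dual (ZMod 2) V // f ≠ 0 ∧ ∀ j, f ≠ P j} ⊕ Fin a) = N by omega)
  let φ : V →ₗ[ZMod 2] (Fin N → ZMod 2) :=
    (LinearMap.funLeft (ZMod 2) (ZMod 2) e.symm).comp (columnMap P q a)
  have hφ (x : V) : hammingNorm (φ x) = hammingNorm (columnMap P q a x) := by
    refine Finset.card_equiv e.symm fun i => ?_
    rw [Finset.mem_filter_univ, Finset.mem_filter_univ]
    rfl
  have hwt {x : V} (hx : x ≠ 0) : hammingNorm (φ x) + hammingNorm (fun j => P j x)
      = 2 ^ k + if q x = 0 then 0 else a := by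
    have h := hammingNorm_columnMap hP q a hx
    rw [hk, pow_succ] at h
    rw [hφ]
    omega
  have hker {x : V} (hx : φ x = 0) : x = 0 := by
    by_contra hne
    have h := hwt hne
    have := hM x
    rw [hx, hammingNorm_zero] at h
    omega
  have hinj : Function.Injective φ := (injective_iff_map_eq_zero φ).2 fun _ => hker
  have hlower {x : V} (hx : x ≠ 0) : 2 ^ k - M ≤ hammingNorm (φ x) := by
    have := hwt hx
    have := hM x
    omega
  have hupper (x : V) : hammingNorm (φ x) ≤ 2 ^ (k + 1) - 2 * M := by
    rcases eq_or_ne x 0 with rfl | hx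
    · simp
    · have := hwt hx
      rw [pow_succ]
      split_ifs at this <;> omega
  refine ⟨LinearMap.range φ, ?_, ?_, ?_, ?_⟩
  · rw [LinearMap.finrank_range_of_inj hinj, hk]
  · obtain ⟨x, hx, hqx, hMx⟩ := hlo
    refine IsLeast.csInf_eq ⟨⟨φ x, ⟨x, rfl⟩, fun h => hx (hker h), ?_⟩, ?_⟩
    · have := hwt hx
      rw [if_pos hqx] at this
      omega
    · rintro _ ⟨_, ⟨y, rfl⟩, hy, rfl⟩
      exact hlower fun h => hy (by rw [h, map_zero])
  · obtain ⟨x, hqx, hMx⟩ := hhi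
    refine IsGreatest.csSup_eq ⟨⟨φ x, ⟨x, rfl⟩, ?_⟩, ?_⟩
    · have := hwt (x := x) (by rintro rfl; exact hqx (map_zero q))
      rw [if_neg hqx] at this
      rw [pow_succ]
      omega
    · rintro _ ⟨_, ⟨y, rfl⟩, rfl⟩
      exact hupper y
  · rintro _ ⟨x, rfl⟩ hx _ ⟨y, rfl⟩ hsub
    rcases eq_or_ne y 0 with rfl | hy
    · exact ⟨0, by simp⟩
    rcases eq_or_ne x y with rfl | hxy
    · exact ⟨1, by simp⟩
    exfalso
    have hsum := hammingNorm_add_of_support_subset (c := φ x) (c' := φ y) fun i hi => hsub hi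
    rw [← map_sub] at hsum
    have hwx := hwt (x := x) (by rintro rfl; exact hx (map_zero φ))
    have hwy := hwt hy
    have hwz := hwt (sub_ne_zero.2 hxy)
    have htri := hammingNorm_add_hammingNorm_sub_le (fun j => P j x) (fun j => P j y)
    have hfun : (fun j => P j x) - (fun j => P j y) = fun j => P j (x - y) := by
      ext j
      simp
    rw [hfun] at htri
    have hMy := hM y
    have hq : q x ≠ 0 → q y ≠ 0 ∨ q (x - y) ≠ 0 := by
      rw [map_sub]
      by_contra! h
      exact h.1 (by simpa [h.2.1] using h.2.2)
    by_cases h1 : q x = 0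
    · rw [if_pos h1] at hwx
      omega
    · rw [if_neg h1] at hwx
      rcases hq h1 with h2 | h2 <;> rw [if_neg h2] at * <;> omega

/-- The even weight code of length `n`. -/
def evenWeightCode (n : ℕ) : Submodule (ZMod 2) (Fin n → ZMod 2) :=
  LinearMap.ker (∑ i, LinearMap.proj i : (Fin n → ZMod 2) →ₗ[ZMod 2] ZMod 2)

lemma mem_evenWeightCode {n : ℕ} {x : Fin n → ZMod 2} :
    x ∈ evenWeightCode n ↔ ∑ i, x i = 0 := by
  simp [evenWeightCode, LinearMap.sum_apply]

lemma natCast_hammingNorm {n : ℕ} (x : Fin n → ZMod 2) :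
    (hammingNorm x : ZMod 2) = ∑ i, x i := by
  rw [hammingNorm, Finset.card_filter, Nat.cast_sum]
  refine Finset.sum_congr rfl fun i _ => ?_
  generalize x i = s
  revert s
  decide

lemma mem_evenWeightCode_iff_even {n : ℕ} {x : Fin n → ZMod 2} :
    x ∈ evenWeightCode n ↔ Even (hammingNorm x) := by
  rw [mem_evenWeightCode, ← natCast_hammingNorm, ZMod.natCast_eq_zero_iff_even]

lemma finrank_evenWeightCode {n : ℕ} (hn : 1 ≤ n) :
    Module.finrank (ZMod 2) (evenWeightCode n) + 1 = n := by
  have hne : (∑ i, LinearMap.proj i : (Fin n → ZMod 2) →ₗ[ZMod 2] ZMod 2) ≠ 0 := by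
    intro h
    have := LinearMap.congr_fun h (Pi.single ⟨0, hn⟩ 1)
    simp [LinearMap.sum_apply] at this
  have := Module.Dual.finrank_ker_add_one_of_ne_zero hne
  rwa [Module.finrank_fin_fun] at this

lemma exists_minimalCode_of_evenWeightCode {n h M N : ℕ} (hn : 3 ≤ n) (hh : 1 ≤ h)
    (hM0 : M ≠ 0) (hM : ∀ x ∈ evenWeightCode n, hammingNorm x ≤ M)
    (hex : ∃ x ∈ evenWeightCode n, hammingNorm x = M) (hMk : 2 * M < 2 ^ (n + h - 2))
    (hN : N + n + 1 + 2 * M = 3 * 2 ^ (n + h - 2)) :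
    ∃ C : Submodule (ZMod 2) (Fin N → ZMod 2),
      Module.finrank (ZMod 2) C = n + h - 1 ∧
      wmin C = 2 ^ (n + h - 2) - M ∧
      wmax C = 2 ^ (n + h - 1) - 2 * M ∧
      IsMinimalCode C := by
  rw [show n + h - 1 = n + h - 2 + 1 by omega]
  have hrank := finrank_evenWeightCode (n := n) (by omega)
  let P (j : Fin n) : Module.Dual (ZMod 2) (evenWeightCode n × (Fin h → ZMod 2)) :=
    LinearMap.proj j ∘ₗ (evenWeightCode n).subtype ∘ₗ LinearMap.fst _ _ _
  have hsep (i j : Fin n) (hij : i ≠ j) : ∃ x, P i x ≠ 0 ∧ P j x = 0 := by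
    obtain ⟨l, hl⟩ : ∃ l, l ∉ ({i, j} : Finset (Fin n)) := by
      by_contra! hall
      have h1 := Finset.card_le_card (fun l _ => hall l : Finset.univ ⊆ ({i, j} : Finset (Fin n)))
      have h2 := Finset.card_le_two (a := i) (b := j)
      rw [Finset.card_univ, Fintype.card_fin] at h1
      omega
    simp only [Finset.mem_insert, Finset.mem_singleton, not_or] at hl
    refine ⟨(⟨Pi.single i 1 + Pi.single l 1, ?_⟩, 0), ?_, ?_⟩
    · simp only [mem_evenWeightCode, Pi.add_apply, Finset.sum_add_distrib]
      simp only [Finset.sum_pi_single', Finset.mem_univ, if_true]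
      decide
    · simp [P, Ne.symm hl.1]
    · simp [P, hij.symm, Ne.symm hl.2]
  refine exists_minimalCode_of_columns P ?_ ?_
    (LinearMap.proj (⟨0, hh⟩ : Fin h) ∘ₗ LinearMap.snd _ _ _) ?_ (fun x => hM _ x.1.2) hMk ?_ ?_ hN
  · intro i j hij
    by_contra hne
    obtain ⟨x, hi, hj⟩ := hsep i j hne
    exact hi (hij ▸ hj)
  · intro i hi
    have : Nontrivial (Fin n) := Fin.nontrivial_iff_two_le.2 (by omega)
    obtain ⟨j, hj⟩ := exists_ne i
    obtain ⟨x, hx, -⟩ := hsep i j hj.symm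
    exact hx (by rw [hi, LinearMap.zero_apply])
  · rw [Module.finrank_prod, Module.finrank_fin_fun]
    omega
  · obtain ⟨x, hx, hxM⟩ := hex
    refine ⟨(⟨x, hx⟩, 0), ?_, by simp, hxM⟩
    intro h0
    have : x = 0 := congrArg (fun y => (y.1 : Fin n → ZMod 2)) h0
    rw [this, hammingNorm_zero] at hxM
    exact hM0 hxM.symm
  · exact ⟨(0, 1), by simp, hammingNorm_zero⟩

lemma exists_hammingNorm_eq {n M : ℕ} (hM : M ≤ n) :
    ∃ x : Fin n → ZMod 2, hammingNorm x = M := by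
  obtain ⟨s, hs⟩ := Finset.exists_subset_card_eq (s := (Finset.univ : Finset (Fin n)))
    (n := M) (by simpa using hM)
  exact ⟨fun i => if i ∈ s then 1 else 0, by simpa [hammingNorm] using hs.2⟩

/-- Proposition 4.11. -/
theorem minimal_code_violating_AB_from_even_weight_codes
    {n h : ℕ} (hn : 3 ≤ n) (hh : 1 ≤ h) :
    (Odd n → 2 ^ (n + h - 3) > n - 1 →
      ∃ C : Submodule (ZMod 2) (Fin (3 * 2 ^ (n + h - 2) - 3 * n + 1) → ZMod 2),
        Module.finrank (ZMod 2) C = n + h - 1 ∧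
        wmin C = 2 ^ (n + h - 2) - n + 1 ∧
        wmax C = 2 ^ (n + h - 1) - 2 * n + 2 ∧
        IsMinimalCode C ∧
        2 * wmin C ≤ (2 - 1) * wmax C) ∧
    (Even n → 2 ^ (n + h - 3) > n →
      ∃ C : Submodule (ZMod 2) (Fin (3 * 2 ^ (n + h - 2) - 3 * n - 1) → ZMod 2),
        Module.finrank (ZMod 2) C = n + h - 1 ∧
        wmin C = 2 ^ (n + h - 2) - n ∧
        wmax C = 2 ^ (n + h - 1) - 2 * n ∧
        IsMinimalCode C ∧
        2 * wmin C ≤ (2 - 1) * wmax C) := by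
  have hpow : 2 ^ (n + h - 2) = 2 * 2 ^ (n + h - 3) := by
    rw [← pow_succ']
    congr 1
    omega
  have hpow' : 2 ^ (n + h - 1) = 2 * 2 ^ (n + h - 2) := by
    rw [← pow_succ']
    congr 1
    omega
  constructor
  · intro hodd hlt
    obtain ⟨x, hx⟩ := exists_hammingNorm_eq (Nat.sub_le n 1)
    obtain ⟨C, hdim, hmin, hmax, hC⟩ := exists_minimalCode_of_evenWeightCode
      (M := n - 1) (N := 3 * 2 ^ (n + h - 2) - 3 * n + 1) hn hh (by omega)
      (fun y hy => by
        have hle : hammingNorm y ≤ n := by simpa using hammingNorm_le_card_fintype (x := y)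
        have hne : hammingNorm y ≠ n := fun h =>
          Nat.not_even_iff_odd.2 hodd (h ▸ mem_evenWeightCode_iff_even.1 hy)
        omega)
      ⟨x, mem_evenWeightCode_iff_even.2 (hx ▸ hodd.tsub_odd odd_one), hx⟩ (by omega) (by omega)
    exact ⟨C, hdim, by omega, by omega, hC, by omega⟩
  · intro heven hlt
    obtain ⟨x, hx⟩ := exists_hammingNorm_eq (le_refl n)
    obtain ⟨C, hdim, hmin, hmax, hC⟩ := exists_minimalCode_of_evenWeightCode
      (M := n) (N := 3 * 2 ^ (n + h - 2) - 3 * n - 1) hn hh (by omega)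
      (fun y _ => by simpa using hammingNorm_le_card_fintype (x := y))
      ⟨x, mem_evenWeightCode_iff_even.2 (by rwa [hx]), hx⟩ (by omega) (by omega)
    exact ⟨C, hdim, hmin, hmax, hC, by omega⟩
end

section
/- Let k ≥ 5 and t ≥ 1 be integers and let u_1, ..., u_t be integers with k−1 > u_t > u_{t−1} > ... > u_1 ≥ 3 and u_1 + u_2 + ... + u_t < k. Then: (i) there exists a self-orthogonal binary linear code (q = 2) with parameters [2^k − 1 − Σ_{i=1}^t (2^{u_i} − 1), k, 2^{k−1} − Σ_{i=1}^t 2^{u_i − 1}]_2 that is a minimal code satisfying the Ashikhmin-Barg condition; and (ii) there exists a self-orthogonal binary linear code with parameters [2^k + 2^{k−1} + t − 1 − Σ_{i=1}^t 2^{u_i + 1}, k, 2^{k−1} − Σ_{i=1}^t 2^{u_i − 1}]_2 that is a minimal code violating the Ashikhmin-Barg condition. -/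
open Finset BigOperators

/-- The binary code whose generator columns are `g (e 0), g (e 1), …`: its words are the values of
the linear functionals of `V` along these columns. -/
def columnCode {V ι : Type} [AddCommGroup V] [Module (ZMod 2) V] {n : ℕ}
    (g : ι → V) (e : Fin n ≃ ι) : Submodule (ZMod 2) (Fin n → ZMod 2) :=
  LinearMap.range
    (LinearMap.pi (fun j => LinearMap.applyₗ (g (e j))) :
      Module.Dual (ZMod 2) V →ₗ[ZMod 2] (Fin n → ZMod 2))

lemma mem_columnCode {V ι : Type} [AddCommGroup V] [Module (ZMod 2) V] {n : ℕ}
    {g : ι → V} {e : Fin n ≃ ι} {c : Fin n → ZMod 2} :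
    c ∈ columnCode g e ↔ ∃ f : Module.Dual (ZMod 2) V, (fun j => f (g (e j))) = c := by
  rfl

lemma hammingNorm_eval {V ι : Type} [AddCommGroup V] [Module (ZMod 2) V] [Fintype ι] {n : ℕ}
    (g : ι → V) (e : Fin n ≃ ι) (f : Module.Dual (ZMod 2) V) :
    hammingNorm (fun j => f (g (e j))) = #{i : ι | f (g i) ≠ 0} := by
  unfold hammingNorm
  refine Finset.card_equiv e fun j => ?_
  simp

lemma selfOrthogonal_of_four_dvd {n : ℕ} (C : Submodule (ZMod 2) (Fin n → ZMod 2))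
    (h : ∀ c ∈ C, 4 ∣ hammingNorm c) : SelfOrthogonal C := by
  intro c hc c' hc'
  have key : hammingNorm (c + c') + 2 * #{i | c i * c' i ≠ 0} =
      hammingNorm c + hammingNorm c' := by
    simp only [hammingNorm, Finset.card_filter, Finset.mul_sum, ← Finset.sum_add_distrib,
      Pi.add_apply]
    exact Finset.sum_congr rfl fun i _ => (by decide : ∀ a b : ZMod 2,
      ((if a + b ≠ 0 then 1 else 0) + 2 * if a * b ≠ 0 then 1 else 0) =
        (if a ≠ 0 then 1 else 0) + if b ≠ 0 then 1 else 0) (c i) (c' i)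
  have h1 := h _ hc
  have h2 := h _ hc'
  have h3 := h _ (C.add_mem hc hc')
  have hsum : ∑ i, c i * c' i = ((#{i | c i * c' i ≠ 0} : ℕ) : ZMod 2) := by
    rw [Finset.card_filter, Nat.cast_sum]
    refine Finset.sum_congr rfl fun i _ => ?_
    generalize c i * c' i = a
    revert a
    decide
  rw [hsum, ZMod.natCast_eq_zero_iff]
  omega

lemma wmin_eq {n d : ℕ} (C : Submodule (ZMod 2) (Fin n → ZMod 2))
    (hle : ∀ c ∈ C, c ≠ 0 → d ≤ hammingNorm c)
    (hex : ∃ c ∈ C, c ≠ 0 ∧ hammingNorm c = d) : wmin C = d := by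
  refine le_antisymm (Nat.sInf_le hex) (le_csInf ⟨d, hex⟩ ?_)
  rintro w ⟨c, hc, h0, rfl⟩
  exact hle c hc h0

lemma hammingNorm_le_wmax {n : ℕ} (C : Submodule (ZMod 2) (Fin n → ZMod 2))
    {c : Fin n → ZMod 2} (hc : c ∈ C) : hammingNorm c ≤ wmax C := by
  refine le_csSup ⟨n, ?_⟩ ⟨c, hc, rfl⟩
  rintro w ⟨c, -, rfl⟩
  simpa using hammingNorm_le_card_fintype (x := c)

lemma wmax_le {n d : ℕ} (C : Submodule (ZMod 2) (Fin n → ZMod 2))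
    (h : ∀ c ∈ C, hammingNorm c ≤ d) : wmax C ≤ d := by
  refine csSup_le ⟨_, 0, C.zero_mem, rfl⟩ ?_
  rintro w ⟨c, hc, rfl⟩
  exact h c hc

/-- The parameters of a binary code read off from the functionals on its columns. -/
lemma columnCode_properties {V ι : Type} [AddCommGroup V] [Module (ZMod 2) V]
    [FiniteDimensional (ZMod 2) V] [Fintype ι] {n d : ℕ} (g : ι → V) (e : Fin n ≃ ι) (hd : 0 < d)
    (hle : ∀ f : Module.Dual (ZMod 2) V, f ≠ 0 → d ≤ #{i : ι | f (g i) ≠ 0})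
    (hex : ∃ f : Module.Dual (ZMod 2) V, f ≠ 0 ∧ #{i : ι | f (g i) ≠ 0} = d)
    (hdvd : ∀ f : Module.Dual (ZMod 2) V, 4 ∣ #{i : ι | f (g i) ≠ 0})
    (hmin : ∀ f h : Module.Dual (ZMod 2) V, f ≠ 0 →
      (∀ i, h (g i) ≠ 0 → f (g i) ≠ 0) → h = 0 ∨ h = f) :
    Module.finrank (ZMod 2) (columnCode g e) = Module.finrank (ZMod 2) V ∧
      wmin (columnCode g e) = d ∧ SelfOrthogonal (columnCode g e) ∧
      IsMinimalCode (columnCode g e) := by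
  have hne : ∀ f : Module.Dual (ZMod 2) V, (fun j => f (g (e j))) = 0 → f = 0 := by
    intro f hf
    by_contra h0
    have h1 := hle f h0
    rw [← hammingNorm_eval g e, hf, hammingNorm_zero] at h1
    omega
  refine ⟨?_, wmin_eq _ ?_ ?_, selfOrthogonal_of_four_dvd _ ?_, ?_⟩
  · rw [columnCode, LinearMap.finrank_range_of_inj, Subspace.dual_finrank_eq]
    rw [← LinearMap.ker_eq_bot, LinearMap.ker_eq_bot']
    exact hne
  · intro c hc h0
    obtain ⟨f, rfl⟩ := mem_columnCode.1 hc
    rw [hammingNorm_eval]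
    refine hle f ?_
    rintro rfl
    exact h0 (by ext; simp)
  · obtain ⟨f, h0, hf⟩ := hex
    exact ⟨_, mem_columnCode.2 ⟨f, rfl⟩, fun h => h0 (hne f h), by rw [hammingNorm_eval, hf]⟩
  · intro c hc
    obtain ⟨f, rfl⟩ := mem_columnCode.1 hc
    rw [hammingNorm_eval]
    exact hdvd f
  · intro c hc h0 c' hc' hsub
    obtain ⟨f, rfl⟩ := mem_columnCode.1 hc
    obtain ⟨h, rfl⟩ := mem_columnCode.1 hc'
    have hf0 : f ≠ 0 := by
      rintro rfl
      exact h0 (by ext; simp)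
    rcases hmin f h hf0 fun i hi => by simpa using @hsub (e.symm i) (by simpa using hi) with
      rfl | rfl
    · exact ⟨0, by ext; simp⟩
    · exact ⟨1, by simp⟩

/-- A nonzero binary functional is nonzero on exactly half of the space. -/
lemma two_mul_card_ne_zero {V : Type} [AddCommGroup V] [Module (ZMod 2) V] [Fintype V]
    (f : Module.Dual (ZMod 2) V) (hf : f ≠ 0) :
    2 * #{v : V | f v ≠ 0} = Fintype.card V := by
  obtain ⟨a, ha⟩ : ∃ a, f a ≠ 0 := by
    by_contra! h
    exact hf (LinearMap.ext h)
  have h1 : #{v : V | f v ≠ 0} = #{v : V | ¬ f v ≠ 0} := by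
    refine Finset.card_equiv (Equiv.addRight a) fun v => ?_
    simp only [mem_filter, mem_univ, true_and, Equiv.coe_addRight, map_add]
    generalize f v = x at *
    generalize f a = y at *
    revert x y
    decide
  have h2 := Finset.card_filter_add_card_filter_not (s := (univ : Finset V)) (fun v => f v ≠ 0)
  rw [Finset.card_univ] at h2
  omega

/-- The nonzero vectors outside the ranges of the maps `φ i`. -/
def outsideRanges {V τ : Type} {U : τ → Type} [Zero V] (φ : ∀ i, U i → V) : Set V :=
  {v | v ≠ 0 ∧ ∀ i w, v ≠ φ i w}

lemma card_filter_eq_outside_add {V τ : Type} {U : τ → Type} [Zero V]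
    [Fintype V] [Fintype τ] [∀ i, Fintype (U i)] (φ : ∀ i, U i → V) [Fintype (outsideRanges φ)]
    (hφ : ∀ i j w w', φ i w = φ j w' → φ i w ≠ 0 → (⟨i, w⟩ : Σ i, U i) = ⟨j, w'⟩)
    (p : V → Prop) [DecidablePred p] (hp : ¬ p 0) :
    #{v : V | p v} = #{v : outsideRanges φ | p v} + ∑ i, #{w : U i | p (φ i w)} := by
  classical
  have h1 : #{v : outsideRanges φ | p v} = #{v : V | p v ∧ ∀ i w, v ≠ φ i w} := by
    rw [← Finset.card_map (Function.Embedding.subtype _)]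
    congr 1
    ext v
    simp only [mem_map, mem_filter, mem_univ, true_and, Function.Embedding.subtype_apply]
    constructor
    · rintro ⟨v, hpv, rfl⟩
      exact ⟨hpv, v.2.2⟩
    · rintro ⟨hpv, hv⟩
      exact ⟨⟨v, fun h => hp (h ▸ hpv), hv⟩, hpv, rfl⟩
  have h2 : ∑ i, #{w : U i | p (φ i w)} = #{v : V | p v ∧ ¬ ∀ i w, v ≠ φ i w} := by
    rw [← Finset.card_sigma]
    refine Finset.card_bij (fun x _ => φ x.1 x.2) ?_ ?_ ?_
    · rintro ⟨i, w⟩ h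
      simp only [mem_sigma, mem_univ, mem_filter, true_and] at h ⊢
      exact ⟨h, fun h' => h' i w rfl⟩
    · rintro ⟨i, w⟩ h ⟨j, w'⟩ - heq
      simp only [mem_sigma, mem_univ, mem_filter, true_and] at h
      exact hφ i j w w' heq fun h' => hp (h' ▸ h)
    · intro v hv
      simp only [mem_filter, mem_univ, true_and, not_forall, not_not] at hv
      obtain ⟨hpv, i, w, rfl⟩ := hv
      exact ⟨⟨i, w⟩, by simpa using hpv, rfl⟩
  rw [h1, h2, ← Finset.filter_filter, ← Finset.filter_filter,
    Finset.card_filter_add_card_filter_not]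

lemma card_filter_sum_const {α V : Type} [Fintype α] {m : ℕ} (g : α → V) (v₀ : V)
    (p : V → Prop) [DecidablePred p] :
    #{i : α ⊕ Fin m | p (Sum.elim g (fun _ => v₀) i)} =
      #{a : α | p (g a)} + if p v₀ then m else 0 := by
  rw [Finset.card_filter, Fintype.sum_sum_type, Finset.card_filter]
  congr 1
  split_ifs <;> simp_all

lemma card_support_add_card_support_sub {V ι : Type} [AddCommGroup V] [Module (ZMod 2) V]
    [Fintype ι] (g : ι → V) (f h : Module.Dual (ZMod 2) V) (hs : ∀ i, h (g i) ≠ 0 → f (g i) ≠ 0) :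
    #{i : ι | h (g i) ≠ 0} + #{i : ι | (f - h) (g i) ≠ 0} = #{i : ι | f (g i) ≠ 0} := by
  simp only [Finset.card_filter, ← Finset.sum_add_distrib, LinearMap.sub_apply]
  refine Finset.sum_congr rfl fun i _ => ?_
  have := hs i
  generalize f (g i) = a at *
  generalize h (g i) = b at *
  revert a b
  decide

/-- The binary space with a block of coordinates for each dimension `u i` and `r` more. -/
abbrev BlockSpace {t : ℕ} (u : Fin t → ℕ) (r : ℕ) : Type :=
  (∀ i, Fin (u i) → ZMod 2) × (Fin r → ZMod 2)

/-- The inclusion of the `i`-th block. -/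
def blockIncl {t : ℕ} (u : Fin t → ℕ) (r : ℕ) (i : Fin t) :
    (Fin (u i) → ZMod 2) →ₗ[ZMod 2] BlockSpace u r :=
  LinearMap.inl (ZMod 2) _ _ ∘ₗ LinearMap.single (ZMod 2) (fun i => Fin (u i) → ZMod 2) i

lemma blockIncl_apply {t : ℕ} (u : Fin t → ℕ) (r : ℕ) (i : Fin t) (w : Fin (u i) → ZMod 2) :
    blockIncl u r i w = (Pi.single i w, 0) := rfl

lemma blockIncl_disjoint {t : ℕ} (u : Fin t → ℕ) (r : ℕ) (i j : Fin t)
    (w : Fin (u i) → ZMod 2) (w' : Fin (u j) → ZMod 2)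
    (h : blockIncl u r i w = blockIncl u r j w') (h0 : blockIncl u r i w ≠ 0) :
    (⟨i, w⟩ : Σ i, Fin (u i) → ZMod 2) = ⟨j, w'⟩ := by
  rw [blockIncl_apply, blockIncl_apply, Prod.mk.injEq] at h
  have hi := congrFun h.1 i
  rw [Pi.single_eq_same] at hi
  by_cases hij : i = j
  · subst hij
    rw [Pi.single_eq_same] at hi
    rw [hi]
  · rw [Pi.single_eq_of_ne hij] at hi
    exact absurd (by rw [hi, map_zero]) h0

lemma finrank_blockSpace {t : ℕ} (u : Fin t → ℕ) (r : ℕ) :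
    Module.finrank (ZMod 2) (BlockSpace u r) = ∑ i, u i + r := by
  simp [Module.finrank_pi_fintype]

lemma card_blockSpace {t : ℕ} (u : Fin t → ℕ) (r : ℕ) :
    Fintype.card (BlockSpace u r) = 2 ^ (∑ i, u i + r) := by
  simp [pow_add, Finset.prod_pow_eq_pow_sum]

lemma blockIncl_injective {t : ℕ} (u : Fin t → ℕ) (r : ℕ) (i : Fin t) :
    Function.Injective (blockIncl u r i) :=
  LinearMap.inl_injective.comp (Pi.single_injective (M := fun i => Fin (u i) → ZMod 2) i)

/-- The columns of the Solomon–Stiffler code: the nonzero vectors outside all blocks. -/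
abbrev solomonStifflerColumns {t : ℕ} (u : Fin t → ℕ) (r : ℕ) : Set (BlockSpace u r) :=
  outsideRanges fun i => blockIncl u r i

noncomputable instance {t : ℕ} (u : Fin t → ℕ) (r : ℕ) : Fintype (solomonStifflerColumns u r) :=
  Fintype.ofFinite _

lemma card_solomonStifflerColumns {t : ℕ} (u : Fin t → ℕ) (r : ℕ) :
    Fintype.card (solomonStifflerColumns u r) + ∑ i, (2 ^ u i - 1) + 1 = 2 ^ (∑ i, u i + r) := by
  have h := card_filter_eq_outside_add (fun i => blockIncl u r i) (blockIncl_disjoint u r)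
    (· ≠ 0) (by simp)
  have h1 : ∀ i, #{w : Fin (u i) → ZMod 2 | blockIncl u r i w ≠ 0} = 2 ^ u i - 1 := by
    intro i
    simp_rw [map_ne_zero_iff _ (blockIncl_injective u r i)]
    rw [Finset.filter_ne', Finset.card_erase_of_mem (mem_univ _), Finset.card_univ]
    simp
  have h2 : #{v : solomonStifflerColumns u r | (v : BlockSpace u r) ≠ 0} =
      Fintype.card (solomonStifflerColumns u r) := by
    rw [Finset.filter_true_of_mem fun v _ => v.2.1, Finset.card_univ]
  rw [Finset.filter_ne', Finset.card_erase_of_mem (mem_univ _), Finset.card_univ,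
    card_blockSpace, h2, Finset.sum_congr rfl fun i _ => h1 i] at h
  have := Nat.one_le_two_pow (n := ∑ i, u i + r)
  omega

lemma exists_card_functional_ne_zero {t : ℕ} (u : Fin t → ℕ) (hu : ∀ i, u i ≠ 0) (r : ℕ)
    (hr : r ≠ 0) (f : Module.Dual (ZMod 2) (BlockSpace u r)) (hf : f ≠ 0) :
    ∃ J : Finset (Fin t), (∀ i, i ∈ J ↔ f ∘ₗ blockIncl u r i ≠ 0) ∧
      #{v : solomonStifflerColumns u r | f v ≠ 0} + ∑ i ∈ J, 2 ^ (u i - 1) =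
        2 ^ (∑ i, u i + r - 1) := by
  have h := card_filter_eq_outside_add (fun i => blockIncl u r i) (blockIncl_disjoint u r)
    (f · ≠ 0) (by simp)
  classical
  refine ⟨univ.filter fun i => f ∘ₗ blockIncl u r i ≠ 0, by simp, ?_⟩
  have h1 : ∀ i, #{w : Fin (u i) → ZMod 2 | f (blockIncl u r i w) ≠ 0} =
      if f ∘ₗ blockIncl u r i ≠ 0 then 2 ^ (u i - 1) else 0 := by
    intro i
    split_ifs with h0
    rotate_left
    · rw [not_not] at h0
      rw [Finset.card_eq_zero, Finset.filter_eq_empty_iff]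
      intro w _
      simpa using LinearMap.congr_fun h0 w
    · have h2 := two_mul_card_ne_zero _ h0
      have h3 := mul_pow_sub_one (hu i) 2
      simp only [LinearMap.comp_apply, Fintype.card_fun, ZMod.card, Fintype.card_fin] at h2
      omega
  have h2 := two_mul_card_ne_zero f hf
  rw [card_blockSpace] at h2
  have h3 := mul_pow_sub_one (show ∑ i, u i + r ≠ 0 by omega) 2
  rw [Finset.sum_congr rfl fun i _ => h1 i, ← Finset.sum_filter] at h
  have h4 : #{v : BlockSpace u r | f v ≠ 0} = 2 ^ (∑ i, u i + r - 1) := by omega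
  rw [← h4]
  exact h.symm

lemma exists_functional_ne_zero_on_blocks {t : ℕ} (u : Fin t → ℕ) (hu : ∀ i, u i ≠ 0) (r : ℕ) :
    ∃ f : Module.Dual (ZMod 2) (BlockSpace u r),
      (∀ i, f ∘ₗ blockIncl u r i ≠ 0) ∧ ∀ w, f (0, w) = 0 := by
  refine ⟨(∑ i, LinearMap.proj ⟨0, Nat.pos_of_ne_zero (hu i)⟩ ∘ₗ
    (LinearMap.proj i : (∀ i, Fin (u i) → ZMod 2) →ₗ[ZMod 2] _)) ∘ₗ LinearMap.fst _ _ _, ?_, ?_⟩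
  · intro i h
    have h1 := LinearMap.congr_fun h (fun _ => 1)
    simp only [LinearMap.comp_apply, blockIncl_apply, LinearMap.fst_apply, LinearMap.sum_apply,
      LinearMap.proj_apply, LinearMap.zero_apply] at h1
    rw [Finset.sum_eq_single i] at h1
    · simp at h1
    · intro j _ hj
      rw [Pi.single_eq_of_ne hj, Pi.zero_apply]
    · simp
  · intro w
    simp

lemma exists_functional_zero_on_blocks {t : ℕ} (u : Fin t → ℕ) (r : ℕ) (hr : r ≠ 0) :
    ∃ f : Module.Dual (ZMod 2) (BlockSpace u r),
      (∀ i, f ∘ₗ blockIncl u r i = 0) ∧ f (0, fun _ => 1) = 1 :=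
  ⟨LinearMap.proj ⟨0, Nat.pos_of_ne_zero hr⟩ ∘ₗ LinearMap.snd _ _ _,
    fun i => by ext; simp [blockIncl_apply], by simp⟩

/-- Proposition 5.0. Self-orthogonal Solomon–Stiffler codes. -/
theorem selfOrthogonal_solomon_stiffler_minimal_codes
    {k t : ℕ} (hk : 5 ≤ k) (ht : 1 ≤ t) (u : Fin t → ℕ)
    (hmono : StrictMono u) (h3 : ∀ i, 3 ≤ u i) (hlt : ∀ i, u i + 1 < k)
    (hsum : ∑ i, u i < k) :
    (∃ C : Submodule (ZMod 2) (Fin (2 ^ k - 1 - ∑ i, (2 ^ u i - 1)) → ZMod 2),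
        Module.finrank (ZMod 2) C = k ∧
        wmin C = 2 ^ (k - 1) - ∑ i, 2 ^ (u i - 1) ∧
        SelfOrthogonal C ∧
        IsMinimalCode C ∧
        2 * wmin C > (2 - 1) * wmax C) ∧
    (∃ C' : Submodule (ZMod 2)
        (Fin (2 ^ k + 2 ^ (k - 1) + t - 1 - ∑ i, 2 ^ (u i + 1)) → ZMod 2),
        Module.finrank (ZMod 2) C' = k ∧
        wmin C' = 2 ^ (k - 1) - ∑ i, 2 ^ (u i - 1) ∧
        SelfOrthogonal C' ∧
        IsMinimalCode C' ∧
        2 * wmin C' ≤ (2 - 1) * wmax C') := by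
  obtain ⟨r, hr, rfl⟩ : ∃ r, r ≠ 0 ∧ k = ∑ i, u i + r := ⟨k - ∑ i, u i, by omega, by omega⟩
  have hu : ∀ i, u i ≠ 0 := fun i => by have := h3 i; omega
  have hcard := card_solomonStifflerColumns u r
  have hweight := exists_card_functional_ne_zero u hu r hr
  have hrank := finrank_blockSpace u r
  obtain ⟨f₀, hf₀, hf₀'⟩ := exists_functional_ne_zero_on_blocks u hu r
  obtain ⟨f₁, hf₁, hf₁'⟩ := exists_functional_zero_on_blocks u r hr
  have hf₀0 : f₀ ≠ 0 := by
    rintro rfl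
    exact hf₀ ⟨0, ht⟩ (by simp)
  have hf₁0 : f₁ ≠ 0 := by
    rintro rfl
    simp at hf₁'
  have hcount : ∑ i, 2 ^ u i = ∑ i, (2 ^ u i - 1) + t := by
    have : ∀ i, 2 ^ u i = (2 ^ u i - 1) + 1 := fun i =>
      (Nat.sub_add_cancel Nat.one_le_two_pow).symm
    rw [Finset.sum_congr rfl fun i _ => this i, Finset.sum_add_distrib]
    simp
  have htwo : ∑ i, 2 ^ u i = 2 * ∑ i, 2 ^ (u i - 1) := by
    rw [Finset.mul_sum]
    exact Finset.sum_congr rfl fun i _ => (mul_pow_sub_one (hu i) 2).symm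
  have htwo' : ∑ i, 2 ^ (u i + 1) = 2 * ∑ i, 2 ^ u i := by
    rw [Finset.mul_sum]
    exact Finset.sum_congr rfl fun i _ => pow_succ' 2 (u i)
  have hpow := mul_pow_sub_one (show ∑ i, u i + r ≠ 0 by omega) 2
  have hlt' : ∑ i, 2 ^ u i < 2 ^ (∑ i, u i + r - 1) := by
    rw [← Finset.sum_image (f := fun j => 2 ^ j) (g := u) hmono.injective.injOn]
    refine Nat.geomSum_lt le_rfl fun j hj => ?_
    obtain ⟨i, -, rfl⟩ := Finset.mem_image.1 hj
    have := hlt i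
    omega
  have hfour : ∀ j, 3 ≤ j → 4 ∣ 2 ^ (j - 1) := fun j hj =>
    pow_dvd_pow 2 (show 2 ≤ j - 1 by omega)
  have hdvd₁ : 4 ∣ 2 ^ (∑ i, u i + r - 1) := hfour _ (by omega)
  have hdvd₂ : 4 ∣ ∑ i, 2 ^ (u i - 1) := Finset.dvd_sum fun i _ => hfour _ (h3 i)
  set K := 2 ^ (∑ i, u i + r - 1)
  set s := ∑ i, 2 ^ (u i - 1)
  set N : Module.Dual (ZMod 2) (BlockSpace u r) → ℕ :=
    fun f => #{v : solomonStifflerColumns u r | f v ≠ 0} with hNdef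
  have hNle : ∀ f, f ≠ 0 → K - s ≤ N f := by
    intro f hf
    obtain ⟨J, -, h⟩ := hweight f hf
    have : ∑ i ∈ J, 2 ^ (u i - 1) ≤ s := Finset.sum_le_univ_sum_of_nonneg fun i => Nat.zero_le _
    simp only [hNdef]
    omega
  have hNub : ∀ f, N f ≤ K := by
    intro f
    by_cases hf : f = 0
    · simp [hNdef, hf]
    · obtain ⟨J, -, h⟩ := hweight f hf
      exact (Nat.le_add_right _ _).trans_eq h
  have hNdvd : ∀ f, 4 ∣ N f := by
    intro f
    by_cases hf : f = 0
    · simp [hNdef, hf]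
    · obtain ⟨J, -, h⟩ := hweight f hf
      exact (Nat.dvd_add_left (Finset.dvd_sum fun i _ => hfour _ (h3 i))).1 (h.symm ▸ hdvd₁)
  have hN₀ : N f₀ = K - s := by
    obtain ⟨J, hJ, h⟩ := hweight f₀ hf₀0
    rw [Finset.eq_univ_of_forall fun i => (hJ i).2 (hf₀ i)] at h
    exact Nat.eq_sub_of_add_eq h
  have hN₁ : N f₁ = K := by
    obtain ⟨J, hJ, h⟩ := hweight f₁ hf₁0
    rw [Finset.eq_empty_of_forall_notMem fun i hi => (hJ i).1 hi (hf₁ i)] at h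
    exact h
  have hmin : ∀ f h : Module.Dual (ZMod 2) (BlockSpace u r),
      (∀ v : solomonStifflerColumns u r, h v ≠ 0 → f v ≠ 0) → h = 0 ∨ h = f := by
    intro f h hs
    by_contra! hne
    have h1 : N h + N (f - h) = N f :=
      card_support_add_card_support_sub (fun v : solomonStifflerColumns u r => (v : BlockSpace u r))
        f h hs
    have h2 := hNle h hne.1
    have h3 := hNle (f - h) (sub_ne_zero.2 hne.2.symm)
    have h4 := hNub f
    omega
  refine ⟨?_, ?_⟩
  · let e : Fin (2 ^ (∑ i, u i + r) - 1 - ∑ i, (2 ^ u i - 1)) ≃ solomonStifflerColumns u r :=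
      (Fintype.equivFinOfCardEq (by omega)).symm
    obtain ⟨hC₁, hC₂, hC₃, hC₄⟩ := columnCode_properties (d := K - s)
      (fun v : solomonStifflerColumns u r => (v : BlockSpace u r)) e (by omega) hNle
      ⟨f₀, hf₀0, hN₀⟩ hNdvd fun f h _ => hmin f h
    refine ⟨_, hC₁.trans hrank, hC₂, hC₃, hC₄, ?_⟩
    have : wmax (columnCode (fun v : solomonStifflerColumns u r => (v : BlockSpace u r)) e) ≤ K := by
      refine wmax_le _ fun c hc => ?_
      obtain ⟨f, rfl⟩ := mem_columnCode.1 hc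
      rw [hammingNorm_eval]
      exact hNub f
    rw [hC₂]
    omega
  · let g : solomonStifflerColumns u r ⊕ Fin (2 * (K - s) - K) → BlockSpace u r :=
      Sum.elim (fun v : solomonStifflerColumns u r => (v : BlockSpace u r)) fun _ => (0, fun _ => 1)
    have hg : ∀ f : Module.Dual (ZMod 2) (BlockSpace u r), #{i | f (g i) ≠ 0} =
        N f + if f (0, fun _ => 1) ≠ 0 then 2 * (K - s) - K else 0 := fun f =>
      card_filter_sum_const _ _ (f · ≠ 0)
    let e : Fin (2 ^ (∑ i, u i + r) + 2 ^ (∑ i, u i + r - 1) + t - 1 - ∑ i, 2 ^ (u i + 1)) ≃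
        solomonStifflerColumns u r ⊕ Fin (2 * (K - s) - K) :=
      (Fintype.equivFinOfCardEq (by
        rw [Fintype.card_sum, Fintype.card_fin]
        omega)).symm
    obtain ⟨hC₁, hC₂, hC₃, hC₄⟩ := columnCode_properties (d := K - s) g e (by omega)
      (fun f hf => by rw [hg]; exact (hNle f hf).trans (Nat.le_add_right _ _))
      ⟨f₀, hf₀0, by rw [hg, hf₀', hN₀]; simp⟩
      (fun f => by
        rw [hg]
        refine dvd_add (hNdvd f) ?_
        split_ifs <;> omega)
      fun f h _ hs => hmin f h fun v => hs (Sum.inl v)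
    refine ⟨_, hC₁.trans hrank, hC₂, hC₃, hC₄, ?_⟩
    have h1 := hammingNorm_le_wmax _ (mem_columnCode.2 ⟨f₁, rfl⟩ : _ ∈ columnCode g e)
    rw [hammingNorm_eval, hg, hf₁', hN₁, if_pos one_ne_zero] at h1
    rw [hC₂]
    omega
end

section
/- Let m ≥ 3 be an integer. Then there exists a self-orthogonal binary linear code (q = 2) with parameters [3·2^{m−1} − 1, m, 2^{m−1}]_2 and maximum weight 2^m that is a minimal code violating the Ashikhmin-Barg condition. -/
open Finset BigOperators

/-- A nonzero vector over `ZMod 2` is non-orthogonal to exactly half of all vectors. -/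
theorem card_dotProduct_ne_zero {k : ℕ} {x : Fin k → ZMod 2} (hx : x ≠ 0) :
    #{v : Fin k → ZMod 2 | x ⬝ᵥ v ≠ 0} = 2 ^ (k - 1) := by
  obtain ⟨t, ht⟩ := Function.ne_iff.mp hx
  have hxt : x t = 1 := by
    have : ∀ a : ZMod 2, a ≠ 0 → a = 1 := by decide
    exact this _ ht
  have hk : k = (k - 1) + 1 := by have := t.pos; omega
  have heq : #{v : Fin k → ZMod 2 | x ⬝ᵥ v ≠ 0} = #{v : Fin k → ZMod 2 | ¬ x ⬝ᵥ v ≠ 0} := by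
    refine Finset.card_equiv (Equiv.addRight (Pi.single t 1)) fun v => ?_
    simp only [Finset.mem_filter, Finset.mem_univ, true_and, Equiv.coe_addRight,
      dotProduct_add, dotProduct_single, hxt, mul_one, not_not]
    generalize x ⬝ᵥ v = a
    revert a
    decide
  have htot := Finset.card_filter_add_card_filter_not (s := (Finset.univ : Finset (Fin k → ZMod 2)))
    (fun v => x ⬝ᵥ v ≠ 0)
  rw [← heq, Finset.card_univ, Fintype.card_fun, ZMod.card, Fintype.card_fin] at htot
  have h2 : 2 ^ k = 2 * 2 ^ (k - 1) := by rw [← pow_succ', ← hk]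
  omega

/-- The binary simplex code of dimension at least three is self-orthogonal. -/
theorem sum_dotProduct_mul_dotProduct_eq_zero {k : ℕ} (hk : 3 ≤ k) (x y : Fin k → ZMod 2) :
    ∑ v : Fin k → ZMod 2, (x ⬝ᵥ v) * (y ⬝ᵥ v) = 0 := by
  have hst : ∀ s t : Fin k, ∑ v : Fin k → ZMod 2, v s * v t = 0 := by
    intro s t
    obtain ⟨u, hu⟩ : ∃ u, u ∉ ({s, t} : Finset (Fin k)) := by
      by_contra! h
      have h1 := Finset.card_le_card (Finset.subset_iff.mpr fun a (_ : a ∈ Finset.univ) => h a)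
      have h2 := Finset.card_le_two (a := s) (b := t)
      rw [Finset.card_univ, Fintype.card_fin] at h1
      omega
    simp only [Finset.mem_insert, Finset.mem_singleton, not_or] at hu
    have hs : ∀ v : Fin k → ZMod 2, (v + Pi.single u 1 : Fin k → ZMod 2) s = v s := fun v => by
      simp [Pi.single_eq_of_ne (Ne.symm hu.1)]
    have ht : ∀ v : Fin k → ZMod 2, (v + Pi.single u 1 : Fin k → ZMod 2) t = v t := fun v => by
      simp [Pi.single_eq_of_ne (Ne.symm hu.2)]
    refine Finset.sum_involution (fun v _ => v + Pi.single u 1) (fun v _ => ?_) (fun v _ _ h => ?_)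
      (fun _ _ => Finset.mem_univ _) (fun v _ => ?_)
    · rw [hs, ht]; exact CharTwo.add_self_eq_zero _
    · have := congrFun h u
      simp at this
    · rw [add_assoc, ← Pi.single_add]
      simp [CharTwo.add_self_eq_zero]
  simp only [dotProduct, Finset.sum_mul_sum]
  rw [Finset.sum_comm]
  refine Finset.sum_eq_zero fun s _ => ?_
  rw [Finset.sum_comm]
  refine Finset.sum_eq_zero fun t _ => ?_
  calc ∑ v : Fin k → ZMod 2, x s * v s * (y t * v t)
      = x s * y t * ∑ v : Fin k → ZMod 2, v s * v t := by
        rw [Finset.mul_sum]; exact Finset.sum_congr rfl fun v _ => by ring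
    _ = 0 := by rw [hst, mul_zero]

/-- Columns of a generator matrix: every nonzero vector once, and a further `2 ^ (m - 1)` copies of
the vector `a`. -/
def extendedSimplexColumn {m : ℕ} (a : Fin m → ZMod 2) :
    {v : Fin m → ZMod 2 // v ≠ 0} ⊕ Fin (2 ^ (m - 1)) → (Fin m → ZMod 2) :=
  Sum.elim Subtype.val fun _ => a

/-- The encoder of the binary code whose generator matrix has the columns `g i`. -/
def columnEncoder {m n : ℕ} (g : Fin n → (Fin m → ZMod 2)) :
    (Fin m → ZMod 2) →ₗ[ZMod 2] (Fin n → ZMod 2) :=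
  (Matrix.of g).mulVecLin

theorem columnEncoder_apply {m n : ℕ} (g : Fin n → (Fin m → ZMod 2)) (x : Fin m → ZMod 2)
    (i : Fin n) : columnEncoder g x i = x ⬝ᵥ g i :=
  dotProduct_comm (g i) x

theorem sum_extendedSimplexColumn {M : Type*} [AddCommMonoid M] {m n : ℕ} (a : Fin m → ZMod 2)
    (e : Fin n ≃ {v : Fin m → ZMod 2 // v ≠ 0} ⊕ Fin (2 ^ (m - 1)))
    (f : (Fin m → ZMod 2) → M) (hf : f 0 = 0) :
    ∑ i, f (extendedSimplexColumn a (e i)) = ∑ v, f v + 2 ^ (m - 1) • f a := by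
  rw [e.sum_comp (fun j => f (extendedSimplexColumn a j)), Fintype.sum_sum_type]
  simp only [extendedSimplexColumn, Sum.elim_inl, Sum.elim_inr, Finset.sum_const, Finset.card_univ,
    Fintype.card_fin]
  congr 1
  rw [← Finset.sum_subtype (Finset.univ.erase 0) (by simp) f, Finset.sum_erase _ hf]

theorem hammingNorm_columnEncoder {m n : ℕ} (a : Fin m → ZMod 2)
    (e : Fin n ≃ {v : Fin m → ZMod 2 // v ≠ 0} ⊕ Fin (2 ^ (m - 1)))
    {x : Fin m → ZMod 2} (hx : x ≠ 0) :
    hammingNorm (columnEncoder (extendedSimplexColumn a ∘ e) x) =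
      2 ^ (m - 1) + if x ⬝ᵥ a ≠ 0 then 2 ^ (m - 1) else 0 := by
  have h := sum_extendedSimplexColumn a e (fun v => if x ⬝ᵥ v ≠ 0 then 1 else 0) (by simp)
  rw [← Finset.card_filter, ← Finset.card_filter, card_dotProduct_ne_zero hx] at h
  simp only [hammingNorm, columnEncoder_apply, Function.comp_apply]
  rw [h]
  split_ifs <;> simp

/-- Proposition 5.1. -/
theorem selfOrthogonal_minimal_code_from_simplex
    {m : ℕ} (hm : 3 ≤ m) :
    ∃ C : Submodule (ZMod 2) (Fin (3 * 2 ^ (m - 1) - 1) → ZMod 2),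
      Module.finrank (ZMod 2) C = m ∧
      wmin C = 2 ^ (m - 1) ∧
      wmax C = 2 ^ m ∧
      SelfOrthogonal C ∧
      IsMinimalCode C ∧
      2 * wmin C ≤ (2 - 1) * wmax C := by
  have hpow : 2 ^ m = 2 * 2 ^ (m - 1) := by rw [← pow_succ', Nat.sub_add_cancel (by omega)]
  have hpos : 0 < 2 ^ (m - 1) := by positivity
  have hcard : Fintype.card (Fin (3 * 2 ^ (m - 1) - 1)) =
      Fintype.card ({v : Fin m → ZMod 2 // v ≠ 0} ⊕ Fin (2 ^ (m - 1))) := by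
    rw [Fintype.card_sum, Fintype.card_subtype_compl, Fintype.card_subtype_eq, Fintype.card_fun,
      ZMod.card, Fintype.card_fin, Fintype.card_fin, Fintype.card_fin]
    omega
  let e := Fintype.equivOfCardEq hcard
  let i₀ : Fin m := ⟨0, by omega⟩
  let i₁ : Fin m := ⟨1, by omega⟩
  have hi : i₀ ≠ i₁ := by simp [i₀, i₁]
  let a : Fin m → ZMod 2 := Pi.single i₀ 1
  let φ := columnEncoder (extendedSimplexColumn a ∘ e)
  have hnorm : ∀ {x}, x ≠ 0 → hammingNorm (φ x) =
      2 ^ (m - 1) + if x ⬝ᵥ a ≠ 0 then 2 ^ (m - 1) else 0 := hammingNorm_columnEncoder a e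
  have hinj : Function.Injective φ := by
    refine (injective_iff_map_eq_zero φ).mpr fun x hφ => ?_
    by_contra hx
    have := hnorm hx
    rw [hφ, hammingNorm_zero] at this
    omega
  have hmin : wmin (LinearMap.range φ) = 2 ^ (m - 1) := by
    refine IsLeast.csInf_eq ⟨⟨φ (Pi.single i₁ 1), ⟨_, rfl⟩, ?_, ?_⟩, ?_⟩
    · rw [Ne, map_eq_zero_iff φ hinj]
      simp
    · rw [hnorm (by simp)]
      simp [a, hi.symm]
    · rintro _ ⟨_, ⟨x, rfl⟩, hx, rfl⟩
      rw [hnorm fun h => hx (by rw [h, map_zero])]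
      exact Nat.le_add_right _ _
  have hmax : wmax (LinearMap.range φ) = 2 ^ m := by
    refine IsGreatest.csSup_eq ⟨⟨φ a, ⟨_, rfl⟩, ?_⟩, ?_⟩
    · rw [hnorm (by simp [a]), if_pos (by simp [a]), hpow, two_mul]
    · rintro _ ⟨_, ⟨x, rfl⟩, rfl⟩
      by_cases hx : x = 0
      · simp [hx]
      · rw [hnorm hx]
        split_ifs <;> omega
  refine ⟨LinearMap.range φ, ?_, hmin, hmax, ?_, ?_, ?_⟩
  · rw [LinearMap.finrank_range_of_inj hinj, Module.finrank_fin_fun]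
  · rintro _ ⟨x, rfl⟩ _ ⟨y, rfl⟩
    simp only [φ, columnEncoder_apply, Function.comp_apply]
    rw [sum_extendedSimplexColumn a e (fun v => (x ⬝ᵥ v) * (y ⬝ᵥ v)) (by simp),
      sum_dotProduct_mul_dotProduct_eq_zero hm, zero_add, nsmul_eq_mul, Nat.cast_pow,
      show ((2 : ℕ) : ZMod 2) = 0 from rfl, zero_pow (by omega), zero_mul]
  · rintro _ ⟨x, rfl⟩ hx _ ⟨y, rfl⟩ hsub
    have hx0 : x ≠ 0 := fun h => hx (by rw [h, map_zero])
    by_cases hy : y = 0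
    · exact ⟨0, by rw [hy, map_zero, zero_smul]⟩
    refine ⟨1, ?_⟩
    have hle : ({v | y ⬝ᵥ v ≠ 0} : Finset (Fin m → ZMod 2)) ⊆
        ({v | x ⬝ᵥ v ≠ 0} : Finset (Fin m → ZMod 2)) := by
      intro v hv
      rw [Finset.mem_filter] at hv ⊢
      refine ⟨hv.1, ?_⟩
      have hv0 : v ≠ 0 := fun h => hv.2 (by rw [h, dotProduct_zero])
      have := @hsub (e.symm (Sum.inl ⟨v, hv0⟩))
      simp only [Set.mem_ofPred_eq, φ, columnEncoder_apply, Function.comp_apply,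
        Equiv.apply_symm_apply, extendedSimplexColumn, Sum.elim_inl] at this
      exact this hv.2
    have hset := Finset.eq_of_subset_of_card_le hle
      (by rw [card_dotProduct_ne_zero hx0, card_dotProduct_ne_zero hy])
    have hbit : ∀ b c : ZMod 2, (b ≠ 0 ↔ c ≠ 0) → b = c := by decide
    ext i
    rw [one_smul]
    simp only [φ, columnEncoder_apply]
    refine hbit _ _ ?_
    simpa using Finset.ext_iff.mp hset ((extendedSimplexColumn a ∘ e) i)
  · rw [hmin, hmax, hpow]
    omega
end

section
/- Let q be a prime power, let k ≥ 1, n ≥ 1, n' ≥ 1 be integers, let r_1, ..., r_k ∈ F_q^n be linearly independent vectors, let C ⊆ F_q^n be their F_q-linear span, and let C* ⊆ F_q^n be the span of r_2, ..., r_k (so C* = C and the second family is empty when k = 1). Let a ∈ F_q^{n'} be a vector all of whose coordinates are nonzero, and let C' ⊆ F_q^{n+n'} be the span of the vectors (a, r_1), (0, r_2), ..., (0, r_k), where (u, v) denotes concatenation and 0 the zero vector of F_q^{n'}. Then for every integer w ≥ 1, the number of codewords of C' of Hamming weight w equals A_w(C*) + #{ y ∈ C \ C* : wt(y) = w − n'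 } (the second term being 0 if w < n'). In particular, the set of nonzero Hamming weights occurring in C' is contained in W ∪ {v + n' : v ∈ W}, where W is the set of nonzero Hamming weights occurring in C, and for each nonzero weight v of C one has A_v(C') ≥ A_v(C*) and A_{v+n'}(C') ≥ A_v(C) − A_v(C*) when v and v + n' do not collide with other listed weights. -/
open Finset BigOperators

theorem hammingNorm_append {F : Type*} [Zero F] [DecidableEq F] {m n : ℕ}
    (u : Fin m → F) (v : Fin n → F) :
    hammingNorm (Fin.append u v) = hammingNorm u + hammingNorm v := by
  simp [hammingNorm, Finset.card_filter, Fin.sum_univ_add]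

theorem hammingNorm_smul_of_forall_ne_zero {F : Type*} [Field F] [DecidableEq F] {m : ℕ}
    {a : Fin m → F} (ha : ∀ j, a j ≠ 0) {t : F} (ht : t ≠ 0) :
    hammingNorm (t • a) = m := by
  simp [hammingNorm, ha, ht]

/-- Prepending a block of zeros, as a linear map. -/
def zeroAppend (F : Type*) [Field F] (m n : ℕ) : (Fin n → F) →ₗ[F] (Fin (m + n) → F) where
  toFun v := Fin.append 0 v
  map_add' u v := by
    ext i
    refine Fin.addCases (fun i => ?_) (fun i => ?_) i <;> simp
  map_smul' t v := by
    ext i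
    refine Fin.addCases (fun i => ?_) (fun i => ?_) i <;> simp

theorem mem_span_extended_iff {F : Type*} [Field F] {m n : ℕ} (a : Fin m → F) (x : Fin n → F)
    {ι : Type*} (r : ι → (Fin n → F)) (S : Set ι) (c : Fin (m + n) → F) :
    c ∈ Submodule.span F ({Fin.append a x} ∪ (fun i => Fin.append (0 : Fin m → F) (r i)) '' S) ↔
      ∃ t : F, ∃ s ∈ Submodule.span F (r '' S), c = Fin.append (t • a) (t • x + s) := by
  have himage : (fun i => Fin.append (0 : Fin m → F) (r i)) '' S =
      zeroAppend F m n '' (r '' S) := by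
    rw [Set.image_image]; rfl
  have happend (t : F) (s : Fin n → F) :
      t • Fin.append a x + zeroAppend F m n s = Fin.append (t • a) (t • x + s) := by
    ext i
    refine Fin.addCases (fun i => ?_) (fun i => ?_) i <;> simp [zeroAppend]
  rw [himage, Submodule.span_union, Submodule.span_image (zeroAppend F m n), Submodule.mem_sup]
  simp only [Submodule.mem_span_singleton, Submodule.mem_map]
  constructor
  · rintro ⟨_, ⟨t, rfl⟩, _, ⟨s, hs, rfl⟩, rfl⟩
    exact ⟨t, s, hs, happend t s⟩
  · rintro ⟨t, s, hs, rfl⟩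
    exact ⟨_, ⟨t, rfl⟩, _, ⟨s, hs, rfl⟩, happend t s⟩

/-- Theorem 6.1. Weight distribution of the extended code `C'`. -/
theorem weight_distribution_of_extended_code
    {F : Type} [Field F] [Fintype F] [DecidableEq F]
    {n n' k : ℕ} (hk : 1 ≤ k) (hn : 1 ≤ n) (hn' : 1 ≤ n')
    (r : Fin k → (Fin n → F)) (hr : LinearIndependent F r)
    (a : Fin n' → F) (ha : ∀ j, a j ≠ 0)
    (C : Submodule F (Fin n → F)) (hC : C = Submodule.span F (Set.range r))
    (Cstar : Submodule F (Fin n → F))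
    (hCstar : Cstar = Submodule.span F (r '' {i : Fin k | (i : ℕ) ≠ 0}))
    (C' : Submodule F (Fin (n' + n) → F))
    (hC' : C' = Submodule.span F
      ({Fin.append a (r ⟨0, hk⟩)} ∪
        (fun i : Fin k => Fin.append (0 : Fin n' → F) (r i)) '' {i : Fin k | (i : ℕ) ≠ 0})) :
    ∀ w : ℕ, 1 ≤ w →
      Set.ncard {c : Fin (n' + n) → F | c ∈ C' ∧ hammingNorm c = w} =
        Set.ncard {c : Fin n → F | c ∈ Cstar ∧ hammingNorm c = w} +
        Set.ncard {y : Fin n → F | y ∈ C ∧ y ∉ Cstar ∧ hammingNorm y + n' = w} := by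
  classical
  intro w _
  set x := r ⟨0, hk⟩ with hx
  have hx_notMem : x ∉ Cstar := by
    rw [hCstar, hx]
    exact hr.notMem_span_image (by simp)
  have hmemC (y : Fin n → F) : y ∈ C ↔ ∃ t : F, ∃ s ∈ Cstar, y = t • x + s := by
    have hrange : Set.range r = {x} ∪ r '' {i : Fin k | (i : ℕ) ≠ 0} := by
      rw [← Set.image_univ, hx, ← Set.image_singleton, ← Set.image_union]
      congr 1
      ext i
      simp [Fin.ext_iff, em]
    rw [hC, hrange, Submodule.span_union, ← hCstar, Submodule.mem_sup]
    simp only [Submodule.mem_span_singleton]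
    constructor
    · rintro ⟨_, ⟨t, rfl⟩, s, hs, rfl⟩
      exact ⟨t, s, hs, rfl⟩
    · rintro ⟨t, s, hs, rfl⟩
      exact ⟨_, ⟨t, rfl⟩, s, hs, rfl⟩
  have hmemC' (c : Fin (n' + n) → F) :
      c ∈ C' ↔ ∃ t : F, ∃ s ∈ Cstar, c = Fin.append (t • a) (t • x + s) := by
    rw [hC', hCstar]
    exact mem_span_extended_iff a x r _ c
  have hmem_smul {t : F} {s : Fin n → F} (hs : s ∈ Cstar) : t • x + s ∈ Cstar ↔ t = 0 := by
    rw [Submodule.add_mem_iff_left _ hs]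
    refine ⟨fun h => ?_, fun h => by simp [h]⟩
    by_contra ht
    exact hx_notMem ((Submodule.smul_mem_iff _ ht).1 h)
  have hinj : Set.InjOn (fun (c : Fin (n' + n) → F) (i : Fin n) => c (Fin.natAdd n' i))
      {c | c ∈ C' ∧ hammingNorm c = w} := by
    rintro c ⟨hc, -⟩ d ⟨hd, -⟩ hcd
    obtain ⟨t, s, hs, rfl⟩ := (hmemC' c).1 hc
    obtain ⟨u, v, hv, rfl⟩ := (hmemC' d).1 hd
    simp only [Fin.append_right] at hcd
    replace hcd : t • x + s = u • x + v := hcd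
    have htu : t = u := by
      rw [← sub_eq_zero, ← hmem_smul (Cstar.sub_mem hs hv)]
      have : (t - u) • x + (s - v) = 0 := by
        rw [sub_smul, sub_add_sub_comm, hcd, sub_self]
      rw [this]
      exact Cstar.zero_mem
    rw [hcd, htu]
  rw [← hinj.ncard_image, ← Set.ncard_union_eq]
  · congr 1
    ext y
    simp only [Set.mem_image, Set.mem_ofPred_eq, Set.mem_union]
    constructor
    · rintro ⟨c, ⟨hc, rfl⟩, rfl⟩
      obtain ⟨t, s, hs, rfl⟩ := (hmemC' c).1 hc
      simp only [Fin.append_right, hammingNorm_append]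
      change (t • x + s ∈ Cstar ∧ hammingNorm (t • x + s) = _) ∨
        (t • x + s ∈ C ∧ t • x + s ∉ Cstar ∧ hammingNorm (t • x + s) + n' = _)
      by_cases ht : t = 0
      · left
        simp [ht, hs]
      · right
        rw [hmem_smul hs, hammingNorm_smul_of_forall_ne_zero ha ht, add_comm n']
        exact ⟨(hmemC _).2 ⟨t, s, hs, rfl⟩, ht, rfl⟩
    · rintro (⟨hy, rfl⟩ | ⟨hy, hy', rfl⟩)
      · refine ⟨Fin.append 0 y, ⟨(hmemC' _).2 ⟨0, y, hy, by simp⟩, ?_⟩, ?_⟩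
        · simp [hammingNorm_append]
        · simp
      · obtain ⟨t, s, hs, rfl⟩ := (hmemC y).1 hy
        have ht : t ≠ 0 := fun h => hy' ((hmem_smul hs).2 h)
        refine ⟨Fin.append (t • a) (t • x + s), ⟨(hmemC' _).2 ⟨t, s, hs, rfl⟩, ?_⟩, ?_⟩
        · rw [hammingNorm_append, hammingNorm_smul_of_forall_ne_zero ha ht, add_comm]
        · simp only [Fin.append_right]
  · exact Set.disjoint_left.2 fun y hy hy' => hy'.2.1 hy.1
end
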